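/- arXiv:1111.7154 — 2 statements merged into one kernel-verified Lean document; each statement's English description precedes it below -/
import Mathlib

section
/- The partial involution f_F realizes the monoidal functoriality combinator: for all partial injective functions a and b on T, (f_F • (!a)) • (!b) = !(a • b). -/
/-- Ground terms over the signature Σ = {ε, l, r, p}. -/
inductive T : Type
  | eps : T
  | l : T → T
  | r : T → T
  | p : T → T → T
  deriving DecidableEq

/-- A relation is functional. -/
def Fnal {α : Type*} (f : α → α → Prop) : Prop :=
  ∀ x y z, f x y → f x z → y = z

/-- A relation is injective. -/
def Inj {α : Type*} (f : α → α → Prop) : Prop :=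
  ∀ x y z, f x z → f y z → x = y

/-- A partial injective function on `T`, viewed as a relation. -/
def PartialInjection (f : T → T → Prop) : Prop := Fnal f ∧ Inj f

/-- A partial involution on `T`: a partial injective function that is symmetric. -/
def PartialInvolution (f : T → T → Prop) : Prop :=
  PartialInjection f ∧ ∀ x y, f x y → f y x

/-- Replication: `!f = {(p(t,u), p(t,v)) | t ∈ T, (u,v) ∈ f}`. -/
def Repl (f : T → T → Prop) : T → T → Prop :=
  fun a b => ∃ t u v, f u v ∧ a = T.p t u ∧ b = T.p t v

/-- Relational composition: `(u,w) ∈ f ; g` iff `∃ v, (u,v) ∈ f ∧ (v,w) ∈ g`. -/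
def RComp (f g : T → T → Prop) : T → T → Prop :=
  fun u w => ∃ v, f u v ∧ g v w

/-- Linear application:
`f • g = f_rr ∪ (f_rl ; g ; (f_ll ; g)* ; f_lr)` where
`f_ij = {(u,v) | (i(u), j(v)) ∈ f}` for `i, j ∈ {l, r}`. -/
def LApp (f g : T → T → Prop) : T → T → Prop :=
  fun u v =>
    f (T.r u) (T.r v) ∨
    RComp (fun a b => f (T.r a) (T.l b))
      (RComp g
        (RComp (Relation.ReflTransGen (RComp (fun a b => f (T.l a) (T.l b)) g))
          (fun a b => f (T.l a) (T.r b)))) u v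

/-- The partial involution realizing the monoidal functoriality combinator `F`: the symmetric
closure of `{(l(p(t,r(u))), r(r(p(t,u))))} ∪ {(l(p(t,l(u))), r(l(p(t,u))))}`. -/
def fF : T → T → Prop := fun a b =>
  (∃ t u, a = T.l (T.p t (T.r u)) ∧ b = T.r (T.r (T.p t u))) ∨
  (∃ t u, a = T.r (T.r (T.p t u)) ∧ b = T.l (T.p t (T.r u))) ∨
  (∃ t u, a = T.l (T.p t (T.l u)) ∧ b = T.r (T.l (T.p t u))) ∨
  (∃ t u, a = T.r (T.l (T.p t u)) ∧ b = T.l (T.p t (T.l u)))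

theorem repl_p_iff (f : T → T → Prop) (s t u v : T) :
    Repl f (T.p s u) (T.p t v) ↔ s = t ∧ f u v := by
  constructor
  · rintro ⟨t', u', v', h, h1, h2⟩
    cases h1
    cases h2
    exact ⟨rfl, h⟩
  · rintro ⟨rfl, h⟩
    exact ⟨s, u, v, h, rfl, rfl⟩

/-- Replication commutes with relational composition. -/
theorem rComp_repl (f g : T → T → Prop) :
    RComp (Repl f) (Repl g) = Repl (RComp f g) := by
  ext x y
  constructor
  · rintro ⟨_, ⟨t, u, v, h, rfl, rfl⟩, t', v', w, h', h1, rfl⟩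
    cases h1
    exact ⟨t, u, w, ⟨v, h, h'⟩, rfl, rfl⟩
  · rintro ⟨t, u, w, ⟨v, h, h'⟩, rfl, rfl⟩
    exact ⟨T.p t v, ⟨t, u, v, h, rfl, rfl⟩, t, v, w, h', rfl, rfl⟩

/-- Replication commutes with iteration, up to the reflexive pairs outside the range of `p`,
which a further composition removes. -/
theorem rComp_reflTransGen_repl (f g : T → T → Prop) :
    RComp (Relation.ReflTransGen (Repl f)) (Repl g) =
      Repl (RComp (Relation.ReflTransGen f) g) := by
  ext x y
  constructor
  · rintro ⟨z, hxz, hzy⟩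
    induction hxz using Relation.ReflTransGen.head_induction_on with
    | refl =>
      obtain ⟨t, u, v, h, rfl, rfl⟩ := hzy
      exact ⟨t, u, v, ⟨u, .refl, h⟩, rfl, rfl⟩
    | head h _ ih =>
      obtain ⟨t, u, v, h, rfl, rfl⟩ := h
      obtain ⟨t', v', w, ⟨s, hs, hg⟩, h1, rfl⟩ := ih
      cases h1
      exact ⟨t, u, w, ⟨s, .head h hs, hg⟩, rfl, rfl⟩
  · rintro ⟨t, u, w, ⟨v, h, h'⟩, rfl, rfl⟩
    exact ⟨T.p t v, h.lift (T.p t) fun c d hcd => ⟨t, c, d, hcd, rfl, rfl⟩,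
      t, v, w, h', rfl, rfl⟩

theorem repl_or (f g : T → T → Prop) (x y : T) :
    Repl (fun u v => f u v ∨ g u v) x y ↔ Repl f x y ∨ Repl g x y := by
  constructor
  · rintro ⟨t, u, v, h | h, rfl, rfl⟩
    · exact .inl ⟨t, u, v, h, rfl, rfl⟩
    · exact .inr ⟨t, u, v, h, rfl, rfl⟩
  · rintro (⟨t, u, v, h, rfl, rfl⟩ | ⟨t, u, v, h, rfl, rfl⟩)
    · exact ⟨t, u, v, .inl h, rfl, rfl⟩
    · exact ⟨t, u, v, .inr h, rfl, rfl⟩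

/-- If the four components of `g` are the replications of those of `a`, then applying `g` to `!b`
replicates `a • b`. -/
theorem lApp_repl_of_components {a g : T → T → Prop} (b : T → T → Prop)
    (hll : (fun x y => g (T.l x) (T.l y)) = Repl fun x y => a (T.l x) (T.l y))
    (hlr : (fun x y => g (T.l x) (T.r y)) = Repl fun x y => a (T.l x) (T.r y))
    (hrl : (fun x y => g (T.r x) (T.l y)) = Repl fun x y => a (T.r x) (T.l y))
    (hrr : (fun x y => g (T.r x) (T.r y)) = Repl fun x y => a (T.r x) (T.r y)) :
    LApp g (Repl b) = Repl (LApp a b) := by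
  ext x y
  have hrr' := congrFun (congrFun hrr x) y
  unfold LApp
  rw [hll, hlr, hrl, hrr', rComp_repl, rComp_reflTransGen_repl, rComp_repl, rComp_repl,
    ← repl_or]

theorem not_fF_l_l (x y : T) : ¬ fF (T.l x) (T.l y) := by simp [fF]

theorem not_fF_r_r (x y : T) : ¬ fF (T.r x) (T.r y) := by simp [fF]

theorem fF_r_l_l_iff (x y : T) :
    fF (T.r (T.l x)) (T.l y) ↔ ∃ t u, x = T.p t u ∧ y = T.p t (T.l u) := by
  simp [fF]

theorem fF_r_r_l_iff (x y : T) :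
    fF (T.r (T.r x)) (T.l y) ↔ ∃ t u, x = T.p t u ∧ y = T.p t (T.r u) := by
  simp [fF]

theorem fF_l_r_iff (x y : T) : fF (T.l x) (T.r y) ↔ fF (T.r y) (T.l x) := by
  simp [fF, and_comm]

/-- Since `f_F` has no `ll` and no `rr` component, applying it conjugates by its `rl` component. -/
theorem lApp_fF_iff (g : T → T → Prop) (x y : T) :
    LApp fF g x y ↔ ∃ c d, fF (T.r x) (T.l c) ∧ g c d ∧ fF (T.r y) (T.l d) := by
  constructor
  · rintro (h | ⟨c, hc, d, hd, e, he, h⟩)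
    · exact (not_fF_r_r _ _ h).elim
    · obtain rfl | ⟨_, ⟨_, h', _⟩, _⟩ := he.cases_head
      · exact ⟨c, d, hc, hd, (fF_l_r_iff _ _).1 h⟩
      · exact (not_fF_l_l _ _ h').elim
  · rintro ⟨c, d, hc, hd, h⟩
    exact .inr ⟨c, hc, d, hd, d, .refl, (fF_l_r_iff _ _).2 h⟩

/-- `f_F` realizes the monoidal functoriality combinator: `(f_F • (!a)) • (!b) = !(a • b)`. -/
theorem fF_realizes_F (a b : T → T → Prop)
    (ha : PartialInjection a) (hb : PartialInjection b) :
    LApp (LApp fF (Repl a)) (Repl b) = Repl (LApp a b) := by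
  apply lApp_repl_of_components <;> ext x y <;>
    simp only [lApp_fF_iff, fF_r_l_l_iff, fF_r_r_l_iff] <;> constructor
  case' hll.mp | hlr.mp | hrl.mp | hrr.mp =>
    rintro ⟨_, _, ⟨t, u, rfl, rfl⟩, h, s, v, rfl, rfl⟩
    obtain ⟨rfl, h'⟩ := (repl_p_iff _ _ _ _ _).1 h
    exact ⟨t, u, v, h', rfl, rfl⟩
  all_goals
    rintro ⟨t, u, v, h, rfl, rfl⟩
    exact ⟨_, _, ⟨t, u, rfl, rfl⟩, ⟨t, _, _, h, rfl, rfl⟩, t, v, rfl, rfl⟩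
end

section
/- Termination in biorthogonal pattern-matching automata is Σ⁰₁-complete: the set H of (codes of) pairs (A, t), where A is a biorthogonal pattern-matching automaton and t ∈ T is a ground term such that there exists t' ∈ T with (q_ι, t) →_A* (q_f, t'), is recursively enumerable, and for every recursively enumerable set W ⊆ ℕ there is a total computable function h : ℕ → ℕ such that n ∈ W if and only if h(n) ∈ H. In particular, H is undecidable (not computable). -/
/-- Terms over Σ with variables drawn from a countably infinite set (here `ℕ`). -/
inductive TV : Type
  | var : ℕ → TV
  | eps : TV
  | l : TV → TV
  | r : TV → TV
  | p : TV → TV → TV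
  deriving DecidableEq

/-- Homomorphic extension of a ground substitution `σ : X → T` to terms with variables. -/
def substG (σ : ℕ → T) : TV → T
  | TV.var n => σ n
  | TV.eps => T.eps
  | TV.l t => T.l (substG σ t)
  | TV.r t => T.r (substG σ t)
  | TV.p t u => T.p (substG σ t) (substG σ u)

/-- Homomorphic extension of a substitution `σ : X → TV` to terms with variables. -/
def substV (σ : ℕ → TV) : TV → TV
  | TV.var n => σ n
  | TV.eps => TV.eps
  | TV.l t => TV.l (substV σ t)
  | TV.r t => TV.r (substV σ t)
  | TV.p t u => TV.p (substV σ t) (substV σ u)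

/-- The set of variables occurring in a term. -/
def varsOf : TV → Finset ℕ
  | TV.var n => {n}
  | TV.eps => ∅
  | TV.l t => varsOf t
  | TV.r t => varsOf t
  | TV.p t u => varsOf t ∪ varsOf u

/-- The number of occurrences of the variable `v` in a term. -/
def occCount (v : ℕ) : TV → ℕ
  | TV.var n => if n = v then 1 else 0
  | TV.eps => 0
  | TV.l t => occCount v t
  | TV.r t => occCount v t
  | TV.p t u => occCount v t + occCount v u

/-- A transition rule `(q, r) → (s, q')`, encoded as the tuple `(q, r, s, q')`. -/
abbrev Rule := ℕ × TV × TV × ℕ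

def ruleSrc (ρ : Rule) : ℕ := ρ.1
def ruleLhs (ρ : Rule) : TV := ρ.2.1
def ruleRhs (ρ : Rule) : TV := ρ.2.2.1
def ruleTgt (ρ : Rule) : ℕ := ρ.2.2.2
def ruleVars (ρ : Rule) : Finset ℕ := varsOf (ruleLhs ρ) ∪ varsOf (ruleRhs ρ)

/-- A pattern-matching automaton: a finite set of states (drawn from `ℕ`), distinguished
initial and final states, and a finite set of transition rules. -/
structure PMA where
  Q : Finset ℕ
  qi : ℕ
  qf : ℕ
  R : Finset Rule

/-- Well-formedness of a pattern-matching automaton: the initial and final states are distinct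
states of the automaton; each rule connects states of the automaton, its right-hand side only
uses variables of its left-hand side, no rule targets the initial state nor leaves the final
state; and distinct rules use disjoint sets of variables. -/
def PMA.WellFormed (A : PMA) : Prop :=
  A.qi ∈ A.Q ∧ A.qf ∈ A.Q ∧ A.qi ≠ A.qf ∧
  (∀ ρ ∈ A.R, ruleSrc ρ ∈ A.Q ∧ ruleTgt ρ ∈ A.Q ∧
    varsOf (ruleRhs ρ) ⊆ varsOf (ruleLhs ρ) ∧ ruleTgt ρ ≠ A.qi ∧ ruleSrc ρ ≠ A.qf) ∧
  (∀ ρ₁ ∈ A.R, ∀ ρ₂ ∈ A.R, ρ₁ ≠ ρ₂ → Disjoint (ruleVars ρ₁) (ruleVars ρ₂))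

/-- Orthogonality: non-ambiguity (left-hand sides of distinct rules with the same source state
are not unifiable) and left-linearity (no variable occurs more than once in a left-hand side). -/
def PMA.Orthogonal (A : PMA) : Prop :=
  (∀ ρ₁ ∈ A.R, ∀ ρ₂ ∈ A.R, ρ₁ ≠ ρ₂ → ruleSrc ρ₁ = ruleSrc ρ₂ →
    ¬ ∃ σ : ℕ → TV, substV σ (ruleLhs ρ₁) = substV σ (ruleLhs ρ₂)) ∧
  (∀ ρ ∈ A.R, ∀ v, occCount v (ruleLhs ρ) ≤ 1)

/-- The dual of a rule. -/
def ruleOp (ρ : Rule) : Rule := (ruleTgt ρ, ruleRhs ρ, ruleLhs ρ, ruleSrc ρ)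

/-- The dual automaton `A^op`. -/
def PMA.op (A : PMA) : PMA := ⟨A.Q, A.qf, A.qi, A.R.image ruleOp⟩

/-- Biorthogonality: both `A` and `A^op` are orthogonal. -/
def PMA.Biorthogonal (A : PMA) : Prop := A.Orthogonal ∧ A.op.Orthogonal

/-- The step relation on configurations induced by a set of rules: `(q,t) → (q',t')` iff some
rule `(q, r) → (s, q')` and ground substitution `σ` satisfy `σ̂(r) = t` and `σ̂(s) = t'`. -/
def StepOf (Rs : Set Rule) : ℕ × T → ℕ × T → Prop :=
  fun c c' => ∃ ρ ∈ Rs, ruleSrc ρ = c.1 ∧ ruleTgt ρ = c'.1 ∧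
    ∃ σ : ℕ → T, substG σ (ruleLhs ρ) = c.2 ∧ substG σ (ruleRhs ρ) = c'.2

/-- The step relation of an automaton. -/
def PMA.Step (A : PMA) : ℕ × T → ℕ × T → Prop := StepOf ↑A.R

/-- The input–output relation induced by a set of rules and initial/final states. -/
def RelOf (Rs : Set Rule) (qi qf : ℕ) : T → T → Prop :=
  fun t t' => Relation.ReflTransGen (StepOf Rs) (qi, t) (qf, t')

/-- The input–output relation `R_A` of an automaton. -/
def PMA.Rel (A : PMA) : T → T → Prop := RelOf ↑A.R A.qi A.qf

/-- A standard effective encoding of ground terms as natural numbers. -/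
def encT : T → ℕ
  | T.eps => 0
  | T.l t => 4 * encT t + 1
  | T.r t => 4 * encT t + 2
  | T.p t u => 4 * Nat.pair (encT t) (encT u) + 3

/-- A standard effective encoding of terms with variables as natural numbers. -/
def encTV : TV → ℕ
  | TV.var n => 5 * n + 4
  | TV.eps => 0
  | TV.l t => 5 * encTV t + 1
  | TV.r t => 5 * encTV t + 2
  | TV.p t u => 5 * Nat.pair (encTV t) (encTV u) + 3

/-- Encoding of a rule as a natural number. -/
def encRule (ρ : Rule) : ℕ :=
  Nat.pair (ruleSrc ρ) (Nat.pair (encTV (ruleLhs ρ)) (Nat.pair (encTV (ruleRhs ρ)) (ruleTgt ρ)))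

/-- Encoding of a list of natural numbers as a natural number. -/
def encList : List ℕ → ℕ
  | [] => 0
  | a :: l => Nat.pair a (encList l) + 1

/-- Encoding of a finite set of natural numbers as a natural number. -/
def encFinsetN (s : Finset ℕ) : ℕ := encList (s.sort (· ≤ ·))

/-- Encoding of a pattern-matching automaton as a natural number. -/
def encPMA (A : PMA) : ℕ :=
  Nat.pair (encFinsetN A.Q)
    (Nat.pair A.qi (Nat.pair A.qf (encFinsetN (A.R.image encRule))))

/-- The halting set `H`: codes of pairs `(A, t)` with `A` a biorthogonal pattern-matching
automaton and `t` a ground term such that `A` started on `t` reaches the final state. -/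
def Hset : Set ℕ :=
  {n | ∃ (A : PMA) (t : T), A.WellFormed ∧ A.Biorthogonal ∧
        n = Nat.pair (encPMA A) (encT t) ∧ ∃ t', A.Rel t t'}

section Decoding

/-- The fold (iterator) on terms with variables. -/
def TV.fold {β : Type*} (fv : ℕ → β) (fe : β) (fl fr : β → β) (fp : β → β → β) : TV → β
  | TV.var n => fv n
  | TV.eps => fe
  | TV.l t => fl (t.fold fv fe fl fr fp)
  | TV.r t => fr (t.fold fv fe fl fr fp)
  | TV.p t u => fp (t.fold fv fe fl fr fp) (u.fold fv fe fl fr fp)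

/-- A total decoding function, left inverse to `encTV`. -/
def decTV (n : ℕ) : TV :=
  if h0 : n % 5 = 0 then TV.eps
  else if n % 5 = 1 then TV.l (decTV (n / 5))
  else if n % 5 = 2 then TV.r (decTV (n / 5))
  else if n % 5 = 3 then
    TV.p (decTV (n / 5).unpair.1) (decTV (n / 5).unpair.2)
  else TV.var (n / 5)
termination_by n
decreasing_by
  · omega
  · omega
  · have := Nat.unpair_left_le (n / 5); omega
  · have := Nat.unpair_right_le (n / 5); omega

theorem decTV_encTV (t : TV) : decTV (encTV t) = t := by
  induction t with
  | var n =>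
    rw [decTV, encTV]
    simp [show (5 * n + 4) % 5 = 4 by omega, show (5 * n + 4) / 5 = n by omega]
  | eps => rw [decTV, encTV]; simp
  | l t ih =>
    rw [decTV, encTV]
    simp [show ∀ n, (5 * n + 1) % 5 = 1 by omega, show ∀ n, (5 * n + 1) / 5 = n by omega, ih]
  | r t ih =>
    rw [decTV, encTV]
    simp [show ∀ n, (5 * n + 2) % 5 = 2 by omega, show ∀ n, (5 * n + 2) / 5 = n by omega, ih]
  | p t u iht ihu =>
    rw [decTV, encTV]
    simp [show ∀ n, (5 * n + 3) % 5 = 3 by omega, show ∀ n, (5 * n + 3) / 5 = n by omega, iht,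
      ihu]

theorem encTV_injective : Function.Injective encTV :=
  Function.LeftInverse.injective decTV_encTV

open Primrec in
theorem TV.primrec_fold {α β : Type*} [Primcodable α] [Primcodable β] {fv : α → ℕ → β}
    {fe : α → β} {fl fr : α → β → β} {fp : α → β × β → β} (hv : Primrec₂ fv) (he : Primrec fe)
    (hl : Primrec₂ fl) (hr : Primrec₂ fr) (hp : Primrec₂ fp) :
    Primrec₂ fun (a : α) (n : ℕ) =>
      (decTV n).fold (fv a) (fe a) (fl a) (fr a) (fun x y => fp a (x, y)) := by
  let g : α → List β → Option β := fun a L =>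
    if L.length % 5 = 0 then some (fe a)
    else if L.length % 5 = 1 then (L[L.length / 5]?).map (fl a)
    else if L.length % 5 = 2 then (L[L.length / 5]?).map (fr a)
    else if L.length % 5 = 3 then
      (L[(L.length / 5).unpair.1]?).bind fun x =>
        (L[(L.length / 5).unpair.2]?).map fun y => fp a (x, y)
    else some (fv a (L.length / 5))
  have hlen : Primrec fun q : α × List β => q.2.length := list_length.comp snd
  have hmod : Primrec fun q : α × List β => q.2.length % 5 := nat_mod.comp hlen (const 5)
  have hdiv : Primrec fun q : α × List β => q.2.length / 5 := nat_div.comp hlen (const 5)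
  have hun : Primrec fun q : α × List β => (q.2.length / 5).unpair := Primrec.unpair.comp hdiv
  refine nat_strong_rec _ (g := g) ?_ ?_
  · refine Primrec.ite (Primrec.eq.comp hmod (const 0)) (option_some.comp (he.comp fst)) ?_
    refine Primrec.ite (Primrec.eq.comp hmod (const 1))
      (option_map (list_getElem?.comp snd hdiv) (hl.comp (fst.comp fst) snd).to₂) ?_
    refine Primrec.ite (Primrec.eq.comp hmod (const 2))
      (option_map (list_getElem?.comp snd hdiv) (hr.comp (fst.comp fst) snd).to₂) ?_
    refine Primrec.ite (Primrec.eq.comp hmod (const 3)) ?_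
      (option_some.comp (hv.comp fst hdiv))
    refine option_bind (list_getElem?.comp snd (fst.comp hun)) ?_
    refine option_map (list_getElem?.comp (snd.comp fst) (snd.comp (hun.comp fst))) ?_
    exact (hp.comp (fst.comp (fst.comp fst)) (Primrec.pair (snd.comp fst) snd)).to₂
  · intro a n
    have h1 : ∀ k ≤ n / 5, n % 5 ≠ 0 → k < n := fun k hk hn => by omega
    conv_rhs => rw [decTV]
    have ha := Nat.unpair_left_le (n / 5)
    have hb := Nat.unpair_right_le (n / 5)
    simp only [g, List.length_map, List.length_range]
    split_ifs with h0 h2 h3 h4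
    · rfl
    · simp [h1 _ le_rfl h0, TV.fold]
    · simp [h1 _ le_rfl h0, TV.fold]
    · simp [h1 _ ha h0, h1 _ hb h0, TV.fold]
    · rfl

/-- Ground terms coded by arbitrary terms: every variable is sent to `ε`. -/
def grd (t : TV) : T := substG (fun _ => T.eps) t

/-- The substitution coded by a list. -/
def listSub (L : List ℕ) (i : ℕ) : T := grd (decTV (L.getD i 0))

theorem encTV_eq_fold (t : TV) : encTV t = t.fold (fun n => 5 * n + 4) 0 (fun x => 5 * x + 1)
    (fun x => 5 * x + 2) (fun x y => 5 * Nat.pair x y + 3) := by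
  induction t <;> simp_all [encTV, TV.fold]

theorem encT_substG_eq_fold (σ : ℕ → T) (t : TV) : encT (substG σ t) =
    t.fold (fun n => encT (σ n)) 0 (fun x => 4 * x + 1)
    (fun x => 4 * x + 2) (fun x y => 4 * Nat.pair x y + 3) := by
  induction t <;> simp_all [encT, substG, TV.fold]

theorem occCount_eq_fold (v : ℕ) (t : TV) : occCount v t =
    t.fold (fun n => if n = v then 1 else 0) 0 id id (fun x y => x + y) := by
  induction t <;> simp_all [occCount, TV.fold]

open Primrec

theorem primrec_affine {α : Type*} [Primcodable α] (a b : ℕ) {f : α → ℕ} (hf : Primrec f) :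
    Primrec fun x => a * f x + b :=
  nat_add.comp (nat_mul.comp (const a) hf) (const b)

theorem primrec_encTV_decTV : Primrec fun n => encTV (decTV n) := by
  have := TV.primrec_fold (α := Unit) (β := ℕ) (fv := fun _ n => 5 * n + 4) (fe := fun _ => 0)
    (fl := fun _ x => 5 * x + 1) (fr := fun _ x => 5 * x + 2)
    (fp := fun _ x => 5 * Nat.pair x.1 x.2 + 3) (primrec_affine _ _ snd) (const _)
    (primrec_affine _ _ snd) (primrec_affine _ _ snd)
    (primrec_affine 5 3 (Primrec₂.natPair.comp (fst.comp snd) (snd.comp snd)))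
  exact (this.comp (const ()) .id).of_eq fun n => (encTV_eq_fold _).symm

theorem primrec_encT_substG {α : Type*} [Primcodable α] {σ : α → ℕ → T}
    (hσ : Primrec₂ fun a n => encT (σ a n)) :
    Primrec₂ fun a n => encT (substG (σ a) (decTV n)) := by
  have := TV.primrec_fold (α := α) (β := ℕ) (fv := fun a n => encT (σ a n)) (fe := fun _ => 0)
    (fl := fun _ x => 4 * x + 1) (fr := fun _ x => 4 * x + 2)
    (fp := fun _ x => 4 * Nat.pair x.1 x.2 + 3) hσ (const _)
    (primrec_affine _ _ snd) (primrec_affine _ _ snd)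
    (primrec_affine 4 3 (Primrec₂.natPair.comp (fst.comp snd) (snd.comp snd)))
  exact this.of_eq fun a n => (encT_substG_eq_fold _ _).symm

theorem primrec_grd : Primrec fun n => encT (grd (decTV n)) :=
  (primrec_encT_substG (α := Unit) (σ := fun _ _ => T.eps) (const _)).comp (const ()) .id

theorem primrec_listSub :
    Primrec₂ fun (L : List ℕ) n => encT (substG (listSub L) (decTV n)) :=
  primrec_encT_substG (primrec_grd.comp ((list_getD 0).comp fst snd))

theorem primrec_occCount : Primrec₂ fun v n => occCount v (decTV n) := by
  have := TV.primrec_fold (α := ℕ) (β := ℕ) (fv := fun v n => if n = v then 1 else 0)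
    (fe := fun _ => 0) (fl := fun _ x => x) (fr := fun _ x => x)
    (fp := fun _ x => x.1 + x.2) (Primrec.ite (Primrec.eq.comp snd fst) (const 1) (const 0))
    (const _) snd snd (nat_add.comp (fst.comp snd) (snd.comp snd))
  exact this.of_eq fun a n => (occCount_eq_fold _ _).symm

/-- Structural compatibility of two terms: no position carries distinct function symbols. -/
def compat : TV → TV → Bool
  | TV.var _, _ => true
  | _, TV.var _ => true
  | TV.eps, TV.eps => true
  | TV.l t, TV.l u => compat t u
  | TV.r t, TV.r u => compat t u
  | TV.p t t', TV.p u u' => compat t u && compat t' u'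
  | _, _ => false

theorem primrec_compat : PrimrecRel fun a b => compat (decTV a) (decTV b) = true := by
  let g : Unit → List Bool → Option Bool := fun _ L =>
    if L.length.unpair.1 % 5 = 4 then some true
    else if L.length.unpair.2 % 5 = 4 then some true
    else if L.length.unpair.1 % 5 = L.length.unpair.2 % 5 then
      if L.length.unpair.1 % 5 = 0 then some true
      else if L.length.unpair.1 % 5 = 3 then
        (L[Nat.pair (L.length.unpair.1 / 5).unpair.1 (L.length.unpair.2 / 5).unpair.1]?).bind
        fun x =>
        (L[Nat.pair (L.length.unpair.1 / 5).unpair.2 (L.length.unpair.2 / 5).unpair.2]?).map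
        fun y => x && y
      else L[Nat.pair (L.length.unpair.1 / 5) (L.length.unpair.2 / 5)]?
    else some false
  have hu : Primrec fun q : Unit × List Bool => q.2.length.unpair :=
    Primrec.unpair.comp (list_length.comp snd)
  have h1 : Primrec fun q : Unit × List Bool => q.2.length.unpair.1 % 5 :=
    nat_mod.comp (fst.comp hu) (const 5)
  have h2 : Primrec fun q : Unit × List Bool => q.2.length.unpair.2 % 5 :=
    nat_mod.comp (snd.comp hu) (const 5)
  have d1 : Primrec fun q : Unit × List Bool => q.2.length.unpair.1 / 5 :=
    nat_div.comp (fst.comp hu) (const 5)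
  have d2 : Primrec fun q : Unit × List Bool => q.2.length.unpair.2 / 5 :=
    nat_div.comp (snd.comp hu) (const 5)
  have key : Primrec₂ fun (_ : Unit) (n : ℕ) => compat (decTV n.unpair.1) (decTV n.unpair.2) := by
    refine nat_strong_rec _ (g := g) ?_ ?_
    · refine Primrec.ite (Primrec.eq.comp h1 (const 4)) (const _) ?_
      refine Primrec.ite (Primrec.eq.comp h2 (const 4)) (const _) ?_
      refine Primrec.ite (Primrec.eq.comp h1 h2) ?_ (const _)
      refine Primrec.ite (Primrec.eq.comp h1 (const 0)) (const _) ?_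
      refine Primrec.ite (Primrec.eq.comp h1 (const 3)) ?_
        (list_getElem?.comp snd (Primrec₂.natPair.comp d1 d2))
      refine option_bind (list_getElem?.comp snd (Primrec₂.natPair.comp
        (fst.comp (Primrec.unpair.comp d1)) (fst.comp (Primrec.unpair.comp d2)))) ?_
      refine option_map (list_getElem?.comp (snd.comp fst) (Primrec₂.natPair.comp
        (snd.comp (Primrec.unpair.comp (d1.comp fst)))
        (snd.comp (Primrec.unpair.comp (d2.comp fst))))) ?_
      exact (Primrec.and.comp (snd.comp fst) snd).to₂
    · intro _ n
      obtain ⟨a, b, rfl⟩ : ∃ a b, n = Nat.pair a b := ⟨_, _, (Nat.pair_unpair n).symm⟩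
      have hlt : ∀ k ≤ a / 5, ∀ m ≤ b / 5, a % 5 ≠ 0 → b % 5 ≠ 0 →
          Nat.pair k m < Nat.pair a b := fun k hk m hm ha hb =>
        (Nat.pair_lt_pair_left _ (by omega)).trans (Nat.pair_lt_pair_right _ (by omega))
      have ha := Nat.unpair_left_le (a / 5)
      have hb := Nat.unpair_right_le (a / 5)
      have ha' := Nat.unpair_left_le (b / 5)
      have hb' := Nat.unpair_right_le (b / 5)
      have e1 : a % 5 < 5 := Nat.mod_lt _ (by norm_num)
      have e2 : b % 5 < 5 := Nat.mod_lt _ (by norm_num)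
      simp only [g, List.length_map, List.length_range, Nat.unpair_pair]
      rw [decTV.eq_def a, decTV.eq_def b]
      generalize hx : a % 5 = x at *
      generalize hy : b % 5 = y at *
      interval_cases x <;> interval_cases y <;> simp [compat, *]
  exact ⟨fun _ => inferInstance,
    ((key.comp (const ()) (Primrec₂.natPair.comp fst snd)).of_eq fun q => by simp)⟩

end Decoding

section Unification

theorem mem_varsOf_iff {v : ℕ} {t : TV} : v ∈ varsOf t ↔ occCount v t ≠ 0 := by
  induction t with
  | var n => simp [varsOf, occCount, eq_comm]
  | eps => simp [varsOf, occCount]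
  | l t ih => simpa [varsOf, occCount] using ih
  | r t ih => simpa [varsOf, occCount] using ih
  | p t u iht ihu => simp only [varsOf, occCount, Finset.mem_union, iht, ihu]; omega

theorem lt_encTV_of_mem_varsOf {v : ℕ} {t : TV} (h : v ∈ varsOf t) : v < encTV t := by
  induction t with
  | var n => simp only [varsOf, Finset.mem_singleton] at h; simp only [encTV]; omega
  | eps => simp [varsOf] at h
  | l t ih => have := ih h; simp only [encTV]; omega
  | r t ih => have := ih h; simp only [encTV]; omega
  | p t u iht ihu =>
    have h1 := Nat.left_le_pair (encTV t) (encTV u)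
    have h2 := Nat.right_le_pair (encTV t) (encTV u)
    simp only [encTV]
    rcases Finset.mem_union.1 h with h | h
    · have := iht h; omega
    · have := ihu h; omega

theorem substV_congr {σ τ : ℕ → TV} {t : TV} (h : ∀ v ∈ varsOf t, σ v = τ v) :
    substV σ t = substV τ t := by
  induction t <;> simp_all [substV, varsOf]

theorem substG_congr {σ τ : ℕ → T} {t : TV} (h : ∀ v ∈ varsOf t, σ v = τ v) :
    substG σ t = substG τ t := by
  induction t <;> simp_all [substG, varsOf]

theorem substV_var (t : TV) : substV TV.var t = t := by
  induction t <;> simp_all [substV]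

theorem compat_of_unifiable {σ : ℕ → TV} {t u : TV} (h : substV σ t = substV σ u) :
    compat t u = true := by
  induction t generalizing u with
  | var n => rfl
  | eps => cases u <;> simp_all [substV, compat]
  | l t ih => cases u <;> simp_all [substV, compat]
  | r t ih => cases u <;> simp_all [substV, compat]
  | p t t' ih ih' => cases u <;> simp_all [substV, compat]

theorem exists_substV_var_eq {x : ℕ} {u : TV} (h : x ∉ varsOf u) :
    ∃ σ : ℕ → TV, substV σ (TV.var x) = substV σ u := by
  refine ⟨fun v => if v = x then u else TV.var v, ?_⟩
  have hu : substV (fun v => if v = x then u else TV.var v) u = u :=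
    (substV_congr fun v hv => if_neg (by rintro rfl; exact h hv)).trans (substV_var u)
  simp [substV, hu]

theorem unifiable_of_compat {t u : TV} (ht : ∀ v, occCount v t ≤ 1) (hu : ∀ v, occCount v u ≤ 1)
    (hd : Disjoint (varsOf t) (varsOf u)) (h : compat t u = true) :
    ∃ σ : ℕ → TV, substV σ t = substV σ u := by
  induction t generalizing u with
  | var n => exact exists_substV_var_eq (by simpa [varsOf] using hd)
  | eps =>
    cases u with
    | var n => exact (exists_substV_var_eq (by simp [varsOf])).imp fun _ => Eq.symm
    | eps => exact ⟨TV.var, rfl⟩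
    | _ => simp [compat] at h
  | l t ih =>
    cases u with
    | var n =>
      exact (exists_substV_var_eq (by simpa [varsOf] using hd)).imp fun _ => Eq.symm
    | l u => exact (ih (u := u) ht hu hd (by simpa [compat] using h)).imp fun σ hσ => congrArg TV.l hσ
    | _ => simp [compat] at h
  | r t ih =>
    cases u with
    | var n =>
      exact (exists_substV_var_eq (by simpa [varsOf] using hd)).imp fun _ => Eq.symm
    | r u => exact (ih (u := u) ht hu hd (by simpa [compat] using h)).imp fun σ hσ => congrArg TV.r hσ
    | _ => simp [compat] at h
  | p t t' ih ih' =>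
    cases u with
    | var n =>
      exact (exists_substV_var_eq (by simpa [varsOf] using hd)).imp fun _ => Eq.symm
    | p u u' =>
      simp only [compat, Bool.and_eq_true] at h
      simp only [occCount] at ht hu
      simp only [varsOf, Finset.disjoint_union_left, Finset.disjoint_union_right] at hd
      obtain ⟨σ, hσ⟩ := ih (fun v => by have := ht v; omega) (fun v => by have := hu v; omega)
        hd.1.1 h.1
      obtain ⟨τ, hτ⟩ := ih' (fun v => by have := ht v; omega) (fun v => by have := hu v; omega)
        hd.2.2 h.2
      have hdis : ∀ v, v ∈ varsOf t' ∪ varsOf u' → v ∉ varsOf t ∪ varsOf u := by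
        intro v hv hv'
        rw [Finset.mem_union] at hv hv'
        have hd1 : v ∈ _ → v ∉ _ := fun h => Finset.disjoint_left.1 hd.1.2 h
        have hd2 : v ∈ _ → v ∉ _ := fun h => Finset.disjoint_left.1 hd.2.1 h
        simp only [mem_varsOf_iff] at hv hv' hd1 hd2
        have := ht v
        have := hu v
        omega
      let ρ : ℕ → TV := fun v => if v ∈ varsOf t ∪ varsOf u then σ v else τ v
      have h1 : ∀ v ∈ varsOf t ∪ varsOf u, ρ v = σ v := fun v hv => if_pos hv
      have h2 : ∀ v ∈ varsOf t' ∪ varsOf u', ρ v = τ v := fun v hv => if_neg (hdis v hv)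
      refine ⟨ρ, ?_⟩
      simp only [substV]
      rw [substV_congr fun v hv => h1 v (Finset.mem_union_left _ hv),
        substV_congr (t := u) fun v hv => h1 v (Finset.mem_union_right _ hv),
        substV_congr (t := t') fun v hv => h2 v (Finset.mem_union_left _ hv),
        substV_congr (t := u') fun v hv => h2 v (Finset.mem_union_right _ hv), hσ, hτ]
    | _ => simp [compat] at h

end Unification

section Enumeration

open Primrec

theorem PrimrecPred.forall_mem {α β : Type*} [Primcodable α] [Primcodable β] {f : α → List β}
    {R : α → β → Prop} (hf : Primrec f) (hR : PrimrecRel R) :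
    PrimrecPred fun a => ∀ b ∈ f a, R a b :=
  (PrimrecRel.forall_mem_list (R := fun b a => R a b) (hR.comp snd fst)).comp hf .id

theorem PrimrecPred.forall_lt_of {α : Type*} [Primcodable α] {f : α → ℕ}
    {R : α → ℕ → Prop} (hf : Primrec f) (hR : PrimrecRel R) :
    PrimrecPred fun a => ∀ b < f a, R a b :=
  (PrimrecPred.forall_mem (list_range.comp hf) hR).of_eq (by simp)

theorem PrimrecPred.imp {α : Type*} [Primcodable α] {p q : α → Prop} (hp : PrimrecPred p)
    (hq : PrimrecPred q) : PrimrecPred fun a => p a → q a :=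
  (hp.not.or hq).of_eq fun _ => by tauto

theorem primrec_mem_list {α : Type*} [Primcodable α] {f : α → ℕ} {g : α → List ℕ}
    (hf : Primrec f) (hg : Primrec g) : PrimrecPred fun a => f a ∈ g a :=
  (PrimrecPred.not (PrimrecPred.forall_mem hg
    (R := fun a b => ¬ b = f a) (Primrec.eq.comp snd (hf.comp fst)).not)).of_eq (by simp)

def stateCodes (a : ℕ) : List ℕ := Denumerable.ofNat (List ℕ) a.unpair.1
def initCode (a : ℕ) : ℕ := a.unpair.2.unpair.1
def finalCode (a : ℕ) : ℕ := a.unpair.2.unpair.2.unpair.1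
def ruleCodes (a : ℕ) : List ℕ := Denumerable.ofNat (List ℕ) a.unpair.2.unpair.2.unpair.2
def srcCode (r : ℕ) : ℕ := r.unpair.1
def lhsCode (r : ℕ) : ℕ := r.unpair.2.unpair.1
def rhsCode (r : ℕ) : ℕ := r.unpair.2.unpair.2.unpair.1
def tgtCode (r : ℕ) : ℕ := r.unpair.2.unpair.2.unpair.2

theorem primrec_unpair_fst : Primrec fun n : ℕ => n.unpair.1 := fst.comp unpair
theorem primrec_unpair_snd : Primrec fun n : ℕ => n.unpair.2 := snd.comp unpair
theorem primrec_stateCodes : Primrec stateCodes := (Primrec.ofNat _).comp primrec_unpair_fst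
theorem primrec_initCode : Primrec initCode := primrec_unpair_fst.comp primrec_unpair_snd
theorem primrec_finalCode : Primrec finalCode := primrec_initCode.comp primrec_unpair_snd
theorem primrec_ruleCodes : Primrec ruleCodes :=
  (Primrec.ofNat _).comp (primrec_unpair_snd.comp (primrec_unpair_snd.comp primrec_unpair_snd))
theorem primrec_srcCode : Primrec srcCode := primrec_unpair_fst
theorem primrec_lhsCode : Primrec lhsCode := primrec_initCode
theorem primrec_rhsCode : Primrec rhsCode := primrec_finalCode
theorem primrec_tgtCode : Primrec tgtCode :=
  primrec_unpair_snd.comp (primrec_unpair_snd.comp primrec_unpair_snd)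

def decRule (r : ℕ) : Rule := (srcCode r, decTV (lhsCode r), decTV (rhsCode r), tgtCode r)

def decPMA (a : ℕ) : PMA :=
  ⟨(stateCodes a).toFinset, initCode a, finalCode a, ((ruleCodes a).map decRule).toFinset⟩

/-- Strict sortedness, with bounded quantifiers. -/
def StrictSorted (L : List ℕ) : Prop := ∀ i < L.length, ∀ j < i, L.getD j 0 < L.getD i 0

theorem strictSorted_iff {L : List ℕ} : StrictSorted L ↔ L.Pairwise (· < ·) := by
  rw [List.pairwise_iff_getElem]
  constructor
  · intro h i j hi hj hij
    have := h j hj i hij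
    rwa [List.getD_eq_getElem _ _ hi, List.getD_eq_getElem _ _ hj] at this
  · intro h i hi j hij
    rw [List.getD_eq_getElem _ _ hi, List.getD_eq_getElem _ _ (hij.trans hi)]
    exact h j i _ _ hij

theorem primrecPred_strictSorted : PrimrecPred StrictSorted := by
  refine PrimrecPred.forall_lt_of list_length ?_
  refine PrimrecPred.forall_lt_of (R := fun (x : List ℕ × ℕ) j => x.1.getD j 0 < x.1.getD x.2 0)
    snd ?_
  exact nat_lt.comp ((list_getD 0).comp (fst.comp fst) snd)
    ((list_getD 0).comp (fst.comp fst) (snd.comp fst))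

theorem encList_eq_encode (L : List ℕ) : encList L = Encodable.encode L := by
  induction L with
  | nil => rfl
  | cons a L ih => simp [encList, ih]

theorem encFinsetN_toFinset {L : List ℕ} (h : StrictSorted L) :
    encFinsetN L.toFinset = Encodable.encode L := by
  rw [strictSorted_iff] at h
  rw [encFinsetN, encList_eq_encode,
    (List.toFinset_sort (· ≤ ·) (h.imp ne_of_lt)).2 (h.imp le_of_lt)]

/-- The natural numbers coding some automaton. -/
def Canonical (a : ℕ) : Prop :=
  StrictSorted (stateCodes a) ∧ StrictSorted (ruleCodes a) ∧
    ∀ r ∈ ruleCodes a, encTV (decTV (lhsCode r)) = lhsCode r ∧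
      encTV (decTV (rhsCode r)) = rhsCode r

theorem primrecPred_canonical : PrimrecPred Canonical := by
  refine (primrecPred_strictSorted.comp primrec_stateCodes).and
    ((primrecPred_strictSorted.comp primrec_ruleCodes).and
    (PrimrecPred.forall_mem primrec_ruleCodes
      (R := fun _ r => encTV (decTV (lhsCode r)) = lhsCode r ∧
      encTV (decTV (rhsCode r)) = rhsCode r) ?_))
  exact (Primrec.eq.comp (primrec_encTV_decTV.comp (primrec_lhsCode.comp snd))
      (primrec_lhsCode.comp snd)).and
    (Primrec.eq.comp (primrec_encTV_decTV.comp (primrec_rhsCode.comp snd))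
      (primrec_rhsCode.comp snd))

theorem encPMA_decPMA {a : ℕ} (h : Canonical a) : encPMA (decPMA a) = a := by
  obtain ⟨h1, h2, h3⟩ := h
  have h4 : (decPMA a).R.image encRule = (ruleCodes a).toFinset := by
    have : ∀ r ∈ ruleCodes a, encRule (decRule r) = r := by
      intro r hr
      simp only [encRule, decRule, ruleSrc, ruleLhs, ruleRhs, ruleTgt, h3 r hr]
      simp [srcCode, lhsCode, rhsCode, tgtCode]
    ext r
    simp only [decPMA, Finset.mem_image, List.mem_toFinset, List.mem_map]
    constructor
    · rintro ⟨_, ⟨r', hr', rfl⟩, rfl⟩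
      rwa [this r' hr']
    · exact fun hr => ⟨_, ⟨r, hr, rfl⟩, this r hr⟩
  rw [encPMA, h4, encFinsetN_toFinset h2]
  simp only [decPMA]
  rw [encFinsetN_toFinset h1]
  simp [stateCodes, ruleCodes, initCode, finalCode]

theorem encRule_injective : Function.Injective encRule := by
  rintro ⟨a, b, c, d⟩ ⟨a', b', c', d'⟩ h
  simp only [encRule, ruleSrc, ruleLhs, ruleRhs, ruleTgt, Nat.pair_eq_pair] at h
  obtain ⟨rfl, h2, h3, rfl⟩ := h
  rw [encTV_injective h2, encTV_injective h3]

@[simp] theorem srcCode_encRule (ρ : Rule) : srcCode (encRule ρ) = ruleSrc ρ := by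
  simp [srcCode, encRule]
@[simp] theorem lhsCode_encRule (ρ : Rule) : lhsCode (encRule ρ) = encTV (ruleLhs ρ) := by
  simp [lhsCode, encRule]
@[simp] theorem rhsCode_encRule (ρ : Rule) : rhsCode (encRule ρ) = encTV (ruleRhs ρ) := by
  simp [rhsCode, encRule]
@[simp] theorem tgtCode_encRule (ρ : Rule) : tgtCode (encRule ρ) = ruleTgt ρ := by
  simp [tgtCode, encRule]
@[simp] theorem initCode_encPMA (A : PMA) : initCode (encPMA A) = A.qi := by
  simp [initCode, encPMA]
@[simp] theorem finalCode_encPMA (A : PMA) : finalCode (encPMA A) = A.qf := by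
  simp [finalCode, encPMA]
theorem stateCodes_encPMA (A : PMA) : stateCodes (encPMA A) = A.Q.sort (· ≤ ·) := by
  simp [stateCodes, encPMA, encFinsetN, encList_eq_encode]
theorem ruleCodes_encPMA (A : PMA) :
    ruleCodes (encPMA A) = (A.R.image encRule).sort (· ≤ ·) := by
  simp [ruleCodes, encPMA, encFinsetN, encList_eq_encode]
@[simp] theorem mem_stateCodes_encPMA {A : PMA} {q : ℕ} :
    q ∈ stateCodes (encPMA A) ↔ q ∈ A.Q := by
  simp [stateCodes_encPMA]
@[simp] theorem mem_ruleCodes_encPMA {A : PMA} {r : ℕ} :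
    r ∈ ruleCodes (encPMA A) ↔ ∃ ρ ∈ A.R, encRule ρ = r := by
  simp [ruleCodes_encPMA]
@[simp] theorem encRule_mem_ruleCodes {A : PMA} {ρ : Rule} :
    encRule ρ ∈ ruleCodes (encPMA A) ↔ ρ ∈ A.R := by
  simp [encRule_injective.eq_iff]
theorem forall_mem_ruleCodes {A : PMA} {P : ℕ → Prop} :
    (∀ r ∈ ruleCodes (encPMA A), P r) ↔ ∀ ρ ∈ A.R, P (encRule ρ) := by
  simp only [mem_ruleCodes_encPMA]
  exact ⟨fun h ρ hρ => h _ ⟨ρ, hρ, rfl⟩, by rintro h _ ⟨ρ, hρ, rfl⟩; exact h ρ hρ⟩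

theorem canonical_encPMA (A : PMA) : Canonical (encPMA A) := by
  refine ⟨?_, ?_, ?_⟩
  · rw [strictSorted_iff, stateCodes_encPMA]
    exact Finset.sortedLT_sort _ |>.pairwise
  · rw [strictSorted_iff, ruleCodes_encPMA]
    exact Finset.sortedLT_sort _ |>.pairwise
  · rw [forall_mem_ruleCodes]
    simp [decTV_encTV]

/-- The variable `v` occurs in the rule with code `r`. -/
def OccCode (v r : ℕ) : Prop :=
  occCount v (decTV (lhsCode r)) ≠ 0 ∨ occCount v (decTV (rhsCode r)) ≠ 0

/-- Well-formedness and biorthogonality, expressed on codes with bounded quantifiers. -/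
def ValidCode (a : ℕ) : Prop :=
  (initCode a ∈ stateCodes a ∧ finalCode a ∈ stateCodes a ∧ initCode a ≠ finalCode a) ∧
  (∀ r ∈ ruleCodes a, (srcCode r ∈ stateCodes a ∧ tgtCode r ∈ stateCodes a ∧
    tgtCode r ≠ initCode a ∧ srcCode r ≠ finalCode a) ∧
    ∀ v < r, (occCount v (decTV (rhsCode r)) ≠ 0 → occCount v (decTV (lhsCode r)) ≠ 0) ∧
      occCount v (decTV (lhsCode r)) ≤ 1 ∧ occCount v (decTV (rhsCode r)) ≤ 1) ∧
  (∀ r ∈ ruleCodes a, ∀ s ∈ ruleCodes a, r ≠ s →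
    (∀ v < r, ¬ (OccCode v r ∧ OccCode v s)) ∧
    (srcCode r = srcCode s → ¬ compat (decTV (lhsCode r)) (decTV (lhsCode s)) = true) ∧
    (tgtCode r = tgtCode s → ¬ compat (decTV (rhsCode r)) (decTV (rhsCode s)) = true))

theorem primrecRel_occCode : PrimrecRel OccCode :=
  (Primrec.eq.comp (primrec_occCount.comp fst (primrec_lhsCode.comp snd)) (const 0)).not.or
    (Primrec.eq.comp (primrec_occCount.comp fst (primrec_rhsCode.comp snd)) (const 0)).not

theorem primrecPred_validCode : PrimrecPred ValidCode := by
  refine ((primrec_mem_list primrec_initCode primrec_stateCodes).and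
    ((primrec_mem_list primrec_finalCode primrec_stateCodes).and
    (Primrec.eq.comp primrec_initCode primrec_finalCode).not)).and
    ((PrimrecPred.forall_mem primrec_ruleCodes ?_).and
    (PrimrecPred.forall_mem primrec_ruleCodes ?_))
  · refine PrimrecPred.and ?_ ?_
    · exact (primrec_mem_list (primrec_srcCode.comp snd) (primrec_stateCodes.comp fst)).and
        ((primrec_mem_list (primrec_tgtCode.comp snd) (primrec_stateCodes.comp fst)).and
        ((Primrec.eq.comp (primrec_tgtCode.comp snd) (primrec_initCode.comp fst)).not.and
        (Primrec.eq.comp (primrec_srcCode.comp snd) (primrec_finalCode.comp fst)).not))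
    · refine PrimrecPred.forall_lt_of (f := fun x : ℕ × ℕ => x.2) snd ?_
      have hl : Primrec fun x : (ℕ × ℕ) × ℕ => occCount x.2 (decTV (lhsCode x.1.2)) :=
        primrec_occCount.comp snd (primrec_lhsCode.comp (snd.comp fst))
      have hr : Primrec fun x : (ℕ × ℕ) × ℕ => occCount x.2 (decTV (rhsCode x.1.2)) :=
        primrec_occCount.comp snd (primrec_rhsCode.comp (snd.comp fst))
      exact ((Primrec.eq.comp hr (const 0)).not.imp (Primrec.eq.comp hl (const 0)).not).and
        ((nat_le.comp hl (const 1)).and (nat_le.comp hr (const 1)))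
  · refine PrimrecPred.forall_mem (f := fun x : ℕ × ℕ => ruleCodes x.1)
      (primrec_ruleCodes.comp fst) ?_
    have hr : Primrec fun x : (ℕ × ℕ) × ℕ => x.1.2 := snd.comp fst
    have hs : Primrec fun x : (ℕ × ℕ) × ℕ => x.2 := snd
    refine (Primrec.eq.comp hr hs).not.imp (PrimrecPred.and ?_ (PrimrecPred.and ?_ ?_))
    · refine PrimrecPred.forall_lt_of hr (PrimrecPred.not (PrimrecPred.and ?_ ?_))
      · exact primrecRel_occCode.comp snd (hr.comp fst)
      · exact primrecRel_occCode.comp snd (hs.comp fst)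
    · exact (Primrec.eq.comp (primrec_srcCode.comp hr) (primrec_srcCode.comp hs)).imp
        (primrec_compat.comp (primrec_lhsCode.comp hr) (primrec_lhsCode.comp hs)).not
    · exact (Primrec.eq.comp (primrec_tgtCode.comp hr) (primrec_tgtCode.comp hs)).imp
        (primrec_compat.comp (primrec_rhsCode.comp hr) (primrec_rhsCode.comp hs)).not

end Enumeration

section Enumeration

open Primrec

theorem ruleOp_injective : Function.Injective ruleOp := by
  rintro ⟨a, b, c, d⟩ ⟨a', b', c', d'⟩ h
  simp_all [ruleOp, ruleSrc, ruleLhs, ruleRhs, ruleTgt]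

theorem orthogonal_op_iff {A : PMA} : A.op.Orthogonal ↔
    (∀ ρ₁ ∈ A.R, ∀ ρ₂ ∈ A.R, ρ₁ ≠ ρ₂ → ruleTgt ρ₁ = ruleTgt ρ₂ →
      ¬ ∃ σ : ℕ → TV, substV σ (ruleRhs ρ₁) = substV σ (ruleRhs ρ₂)) ∧
    (∀ ρ ∈ A.R, ∀ v, occCount v (ruleRhs ρ) ≤ 1) := by
  simp only [PMA.Orthogonal, PMA.op, Finset.forall_mem_image, ruleOp_injective.ne_iff]
  rfl

theorem lt_encRule_of_mem_ruleVars {v : ℕ} {ρ : Rule} (h : v ∈ ruleVars ρ) : v < encRule ρ := by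
  have h1 := Nat.right_le_pair (ruleSrc ρ)
    (Nat.pair (encTV (ruleLhs ρ)) (Nat.pair (encTV (ruleRhs ρ)) (ruleTgt ρ)))
  have h2 := Nat.left_le_pair (encTV (ruleLhs ρ)) (Nat.pair (encTV (ruleRhs ρ)) (ruleTgt ρ))
  have h3 := Nat.right_le_pair (encTV (ruleLhs ρ)) (Nat.pair (encTV (ruleRhs ρ)) (ruleTgt ρ))
  have h4 := Nat.left_le_pair (encTV (ruleRhs ρ)) (ruleTgt ρ)
  rw [encRule]
  rcases Finset.mem_union.1 h with h | h <;> have := lt_encTV_of_mem_varsOf h <;> omega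

theorem occCode_encRule {v : ℕ} {ρ : Rule} : OccCode v (encRule ρ) ↔ v ∈ ruleVars ρ := by
  simp [OccCode, decTV_encTV, ruleVars, mem_varsOf_iff]

theorem occCount_eq_zero_of_le {v : ℕ} {ρ : Rule} (h : encRule ρ ≤ v) :
    occCount v (ruleLhs ρ) = 0 ∧ occCount v (ruleRhs ρ) = 0 := by
  have : v ∉ ruleVars ρ := fun hv => (lt_encRule_of_mem_ruleVars hv).not_ge h
  simpa [ruleVars, mem_varsOf_iff] using this

theorem validCode_encPMA {A : PMA} :
    ValidCode (encPMA A) ↔ A.WellFormed ∧ A.Biorthogonal := by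
  rw [ValidCode, PMA.Biorthogonal, orthogonal_op_iff, PMA.Orthogonal, PMA.WellFormed]
  simp only [forall_mem_ruleCodes, mem_stateCodes_encPMA, initCode_encPMA, finalCode_encPMA,
    srcCode_encRule, tgtCode_encRule, lhsCode_encRule, rhsCode_encRule, decTV_encTV,
    occCode_encRule, encRule_injective.ne_iff]
  constructor
  · rintro ⟨⟨h1, h2, h3⟩, h4, h5⟩
    have h6 : ∀ ρ ∈ A.R, ∀ v, (occCount v (ruleRhs ρ) ≠ 0 → occCount v (ruleLhs ρ) ≠ 0) ∧
        occCount v (ruleLhs ρ) ≤ 1 ∧ occCount v (ruleRhs ρ) ≤ 1 := by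
      intro ρ hρ v
      rcases lt_or_ge v (encRule ρ) with hv | hv
      · exact (h4 ρ hρ).2 v hv
      · obtain ⟨e1, e2⟩ := occCount_eq_zero_of_le hv
        simp [e1, e2]
    refine ⟨⟨h1, h2, h3, fun ρ hρ => ?_, fun ρ hρ ρ' hρ' hne => ?_⟩,
      ⟨fun ρ hρ ρ' hρ' hne he hu => ?_, fun ρ hρ v => (h6 ρ hρ v).2.1⟩,
      ⟨fun ρ hρ ρ' hρ' hne he hu => ?_, fun ρ hρ v => (h6 ρ hρ v).2.2⟩⟩
    · obtain ⟨⟨a, b, c, d⟩, -⟩ := h4 ρ hρ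
      refine ⟨a, b, fun v hv => ?_, c, d⟩
      rw [mem_varsOf_iff] at hv ⊢
      exact (h6 ρ hρ v).1 hv
    · rw [Finset.disjoint_left]
      exact fun v hv hv' => (h5 ρ hρ ρ' hρ' hne).1 v (lt_encRule_of_mem_ruleVars hv) ⟨hv, hv'⟩
    · obtain ⟨σ, hσ⟩ := hu
      exact (h5 ρ hρ ρ' hρ' hne).2.1 he (compat_of_unifiable hσ)
    · obtain ⟨σ, hσ⟩ := hu
      exact (h5 ρ hρ ρ' hρ' hne).2.2 he (compat_of_unifiable hσ)
  · rintro ⟨⟨h1, h2, h3, h4, h5⟩, ⟨h6, h7⟩, h8, h9⟩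
    refine ⟨⟨h1, h2, h3⟩, fun ρ hρ => ?_, fun ρ hρ ρ' hρ' hne => ⟨?_, ?_, ?_⟩⟩
    · obtain ⟨a, b, c, d, e⟩ := h4 ρ hρ
      refine ⟨⟨a, b, d, e⟩, fun v _ => ⟨?_, h7 ρ hρ v, h9 ρ hρ v⟩⟩
      rw [← mem_varsOf_iff, ← mem_varsOf_iff]
      exact fun h => c h
    · exact fun v _ h => Finset.disjoint_left.1 (h5 ρ hρ ρ' hρ' hne) h.1 h.2
    · exact fun he hc => h6 ρ hρ ρ' hρ' hne he (unifiable_of_compat (h7 ρ hρ) (h7 ρ' hρ')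
        ((h5 ρ hρ ρ' hρ' hne).mono Finset.subset_union_left Finset.subset_union_left) hc)
    · exact fun he hc => h8 ρ hρ ρ' hρ' hne he (unifiable_of_compat (h9 ρ hρ) (h9 ρ' hρ')
        ((h5 ρ hρ ρ' hρ' hne).mono Finset.subset_union_right Finset.subset_union_right) hc)

theorem encT_injective : Function.Injective encT := by
  intro t u h
  induction t generalizing u with
  | eps => cases u <;> simp_all [encT]
  | l t ih =>
    cases u with
    | l u => exact congrArg T.l (ih (by simpa [encT] using h))
    | _ => simp [encT] at h; try omega
  | r t ih =>
    cases u with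
    | r u => exact congrArg T.r (ih (by simpa [encT] using h))
    | _ => simp [encT] at h; try omega
  | p t t' ih ih' =>
    cases u with
    | p u u' =>
      have h' : encT t = encT u ∧ encT t' = encT u' := by simpa [encT] using h
      rw [ih h'.1, ih' h'.2]
    | _ => simp [encT] at h; try omega

/-- Ground terms as terms with variables. -/
def T.toTV : T → TV
  | T.eps => TV.eps
  | T.l t => TV.l t.toTV
  | T.r t => TV.r t.toTV
  | T.p t u => TV.p t.toTV u.toTV

theorem grd_toTV (t : T) : grd t.toTV = t := by
  induction t <;> simp_all [grd, T.toTV, substG]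

/-- Applying the rule with code `b.1` and the substitution coded by `b.2` to a configuration. -/
def stepCode (a : ℕ) (b : ℕ × List ℕ) (c : ℕ × ℕ) : Option (ℕ × ℕ) :=
  if b.1 ∈ ruleCodes a ∧ srcCode b.1 = c.1 ∧
      encT (substG (listSub b.2) (decTV (lhsCode b.1))) = c.2 then
    some (tgtCode b.1, encT (substG (listSub b.2) (decTV (rhsCode b.1))))
  else none

def runCode (a : ℕ) (c : ℕ × ℕ) (s : List (ℕ × List ℕ)) : Option (ℕ × ℕ) :=
  s.foldl (fun o b => o.bind (stepCode a b)) (some c)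

theorem primrec_stepCode :
    Primrec fun x : (ℕ × (ℕ × List ℕ)) × (ℕ × ℕ) => stepCode x.1.1 x.1.2 x.2 := by
  have hr : Primrec fun x : (ℕ × (ℕ × List ℕ)) × (ℕ × ℕ) => x.1.2.1 :=
    fst.comp (snd.comp fst)
  have hL : Primrec fun x : (ℕ × (ℕ × List ℕ)) × (ℕ × ℕ) => x.1.2.2 :=
    snd.comp (snd.comp fst)
  have hc : PrimrecPred fun x : (ℕ × (ℕ × List ℕ)) × (ℕ × ℕ) =>
      x.1.2.1 ∈ ruleCodes x.1.1 ∧ srcCode x.1.2.1 = x.2.1 ∧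
      encT (substG (listSub x.1.2.2) (decTV (lhsCode x.1.2.1))) = x.2.2 :=
    (primrec_mem_list hr (primrec_ruleCodes.comp (fst.comp fst))).and
      ((Primrec.eq.comp (primrec_srcCode.comp hr) (fst.comp snd)).and
      (Primrec.eq.comp (primrec_listSub.comp hL (primrec_lhsCode.comp hr)) (snd.comp snd)))
  exact Primrec.ite hc (option_some.comp ((primrec_tgtCode.comp hr).pair
      (primrec_listSub.comp hL (primrec_rhsCode.comp hr)))) (const none)

theorem primrec_runCode {α : Type*} [Primcodable α] {a : α → ℕ} {c : α → ℕ × ℕ}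
    {s : α → List (ℕ × List ℕ)} (ha : Primrec a) (hc : Primrec c) (hs : Primrec s) :
    Primrec fun x => runCode (a x) (c x) (s x) := by
  have hstep : Primrec₂ fun x (y : Option (ℕ × ℕ) × (ℕ × List ℕ)) =>
      y.1.bind (stepCode (a x) y.2) := by
    refine option_bind (fst.comp snd) ?_
    have : Primrec fun z : (α × (Option (ℕ × ℕ) × (ℕ × List ℕ))) × (ℕ × ℕ) =>
        ((a z.1.1, z.1.2.2), z.2) :=
      ((ha.comp (fst.comp fst)).pair (snd.comp (snd.comp fst))).pair snd
    exact (primrec_stepCode.comp this).to₂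
  exact list_foldl hs (option_some.comp hc) hstep

theorem exists_step_of_stepCode {A : PMA} {b : ℕ × List ℕ} {q : ℕ} {t : T} {c : ℕ × ℕ}
    (h : stepCode (encPMA A) b (q, encT t) = some c) :
    ∃ c' : ℕ × T, c = (c'.1, encT c'.2) ∧ A.Step (q, t) c' := by
  rw [stepCode] at h
  split at h
  · next hb =>
    obtain ⟨h1, h2, h3⟩ := hb
    obtain ⟨ρ, hρ, hb⟩ := mem_ruleCodes_encPMA.1 h1
    rw [← hb] at h h2 h3
    simp only [lhsCode_encRule, rhsCode_encRule, srcCode_encRule, tgtCode_encRule, decTV_encTV,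
      Option.some.injEq] at h h2 h3
    exact ⟨(_, _), h.symm, ρ, hρ, h2, rfl, _, encT_injective h3, rfl⟩
  · simp at h

theorem exists_stepCode_of_step {A : PMA} {c c' : ℕ × T} (h : A.Step c c') :
    ∃ b, stepCode (encPMA A) b (c.1, encT c.2) = some (c'.1, encT c'.2) := by
  obtain ⟨ρ, hρ, h1, h2, σ, h3, h4⟩ := h
  let N := encTV (ruleLhs ρ) + encTV (ruleRhs ρ)
  let L := (List.range N).map fun i => encTV (σ i).toTV
  have hL : ∀ i < N, listSub L i = σ i := by
    intro i hi
    simp [listSub, L, List.getD_eq_getElem?_getD, hi, decTV_encTV, grd_toTV]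
  have hl : substG (listSub L) (ruleLhs ρ) = c.2 := by
    rw [← h3]
    exact substG_congr fun v hv => hL v (by have := lt_encTV_of_mem_varsOf hv; omega)
  have hr : substG (listSub L) (ruleRhs ρ) = c'.2 := by
    rw [← h4]
    exact substG_congr fun v hv => hL v (by have := lt_encTV_of_mem_varsOf hv; omega)
  refine ⟨(encRule ρ, L), ?_⟩
  rw [stepCode, if_pos]
  · simp only [rhsCode_encRule, tgtCode_encRule, decTV_encTV, hr, h2]
  · exact ⟨encRule_mem_ruleCodes.2 hρ, by simpa using h1, by simp [decTV_encTV, hl]⟩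

theorem exists_reflTransGen_of_runCode {A : PMA} {q : ℕ} {t : T} (s : List (ℕ × List ℕ)) :
    ∀ {c : ℕ × ℕ}, runCode (encPMA A) (q, encT t) s = some c →
    ∃ c' : ℕ × T, c = (c'.1, encT c'.2) ∧ Relation.ReflTransGen A.Step (q, t) c' := by
  induction s using List.reverseRecOn with
  | nil =>
    intro c h
    exact ⟨(q, t), by simpa [runCode, eq_comm] using h, .refl⟩
  | append_singleton s b ih =>
    intro c h
    rw [runCode, List.foldl_append, ← runCode] at h
    obtain ⟨d, hd, hc⟩ := Option.bind_eq_some_iff.1 h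
    obtain ⟨d', rfl, hd'⟩ := ih hd
    obtain ⟨c', rfl, hc'⟩ := exists_step_of_stepCode hc
    exact ⟨c', rfl, hd'.tail hc'⟩

theorem exists_runCode_of_reflTransGen {A : PMA} {c c' : ℕ × T}
    (h : Relation.ReflTransGen A.Step c c') :
    ∃ s, runCode (encPMA A) (c.1, encT c.2) s = some (c'.1, encT c'.2) := by
  induction h with
  | refl => exact ⟨[], rfl⟩
  | tail _ hs ih =>
    obtain ⟨s, ih⟩ := ih
    obtain ⟨b, hb⟩ := exists_stepCode_of_step hs
    refine ⟨s ++ [b], ?_⟩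
    rw [runCode, List.foldl_append, ← runCode, ih]
    exact hb

/-- `w` witnesses that `n` is the code of a halting computation. -/
def Witness (n : ℕ) (w : ℕ × List (ℕ × List ℕ)) : Prop :=
  Canonical n.unpair.1 ∧ ValidCode n.unpair.1 ∧ encT (grd (decTV w.1)) = n.unpair.2 ∧
    (runCode n.unpair.1 (initCode n.unpair.1, n.unpair.2) w.2).map Prod.fst =
      some (finalCode n.unpair.1)

theorem primrecRel_witness : PrimrecRel Witness := by
  have ha : Primrec fun x : ℕ × (ℕ × List (ℕ × List ℕ)) => x.1.unpair.1 :=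
    primrec_unpair_fst.comp fst
  have ht : Primrec fun x : ℕ × (ℕ × List (ℕ × List ℕ)) => x.1.unpair.2 :=
    primrec_unpair_snd.comp fst
  refine (primrecPred_canonical.comp ha).and ((primrecPred_validCode.comp ha).and
    ((Primrec.eq.comp (primrec_grd.comp (fst.comp snd)) ht).and (Primrec.eq.comp ?_ ?_)))
  · exact option_map (primrec_runCode ha ((primrec_initCode.comp ha).pair ht) (snd.comp snd))
      (fst.comp snd)
  · exact option_some.comp (primrec_finalCode.comp ha)

theorem mem_Hset_iff_exists_witness {n : ℕ} : n ∈ Hset ↔ ∃ w, Witness n w := by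
  constructor
  · rintro ⟨A, t, hw, hb, rfl, t', h⟩
    obtain ⟨s, hs⟩ := exists_runCode_of_reflTransGen h
    refine ⟨(encTV t.toTV, s), ?_⟩
    simp only [Witness, Nat.unpair_pair, initCode_encPMA, finalCode_encPMA, hs, decTV_encTV,
      grd_toTV]
    exact ⟨canonical_encPMA A, validCode_encPMA.2 ⟨hw, hb⟩, trivial, rfl⟩
  · rintro ⟨w, hc, hv, ht, hr⟩
    have ha := encPMA_decPMA hc
    set A := decPMA n.unpair.1
    rw [← ha] at hv hr
    rw [← ht] at hr
    obtain ⟨c, hc, hc'⟩ := Option.map_eq_some_iff.1 hr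
    obtain ⟨c', rfl, h⟩ := exists_reflTransGen_of_runCode _ hc
    rw [initCode_encPMA] at h
    rw [finalCode_encPMA] at hc'
    obtain ⟨hw, hb⟩ := validCode_encPMA.1 hv
    refine ⟨A, grd (decTV w.1), hw, hb, ?_, c'.2, ?_⟩
    · rw [ha, ht, Nat.pair_unpair]
    · rw [PMA.Rel, RelOf, ← hc']
      exact h

theorem exists_partrec_dom_iff_mem_Hset :
    ∃ f : ℕ →. ℕ, Nat.Partrec f ∧ ∀ n, n ∈ Hset ↔ (f n).Dom := by
  classical
  let P : ℕ → ℕ → Bool := fun n k =>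
    decide (Witness n (Denumerable.ofNat (ℕ × List (ℕ × List ℕ)) k))
  have hP : Primrec₂ P :=
    (primrecRel_witness.comp fst ((Primrec.ofNat _).comp snd)).decide
  refine ⟨fun n => Nat.rfind fun k => Part.some (P n k),
    Partrec.nat_iff.1 (Partrec.rfind hP.to_comp.partrec₂), fun n => ?_⟩
  refine mem_Hset_iff_exists_witness.trans (Iff.trans ?_ Nat.rfind_dom.symm)
  constructor
  · rintro ⟨w, hw⟩
    refine ⟨Encodable.encode w, ?_, fun _ => trivial⟩
    simp only [P, Denumerable.ofNat_encode, hw, decide_true, Part.mem_some_iff]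
  · rintro ⟨k, hk, -⟩
    exact ⟨_, of_decide_eq_true (Part.mem_some_iff.1 hk).symm⟩

end Enumeration

section StackMachine

open Turing.PartrecToTM2 (Γ' K')

/-- A two-letter prefix code for the stack symbols. -/
def symT : Γ' → T → T
  | Γ'.consₗ, x => T.l (T.l x)
  | Γ'.cons, x => T.l (T.r x)
  | Γ'.bit0, x => T.r (T.l x)
  | Γ'.bit1, x => T.r (T.r x)

/-- The prefix code `symT` for terms with variables. -/
def symV : Γ' → TV → TV
  | Γ'.consₗ, x => TV.l (TV.l x)
  | Γ'.cons, x => TV.l (TV.r x)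
  | Γ'.bit0, x => TV.r (TV.l x)
  | Γ'.bit1, x => TV.r (TV.r x)

/-- The term coding a stack. -/
def wordT (w : List Γ') : T := w.foldr symT T.eps

def wordV (w : List Γ') (t : TV) : TV := w.foldr symV t

/-- The term coding a history and four stacks. -/
def confT (h : T) (f : K' → T) : T :=
  T.p h (T.p (T.p (f K'.main) (f K'.rev)) (T.p (f K'.aux) (f K'.stack)))

def confV (h : TV) (f : K' → TV) : TV :=
  TV.p h (TV.p (TV.p (f K'.main) (f K'.rev)) (TV.p (f K'.aux) (f K'.stack)))

/-- Extending a history by the index `e`. -/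
def recT (e : ℕ) (h : T) : T := T.l^[e] (T.r h)

def recV (e : ℕ) (h : TV) : TV := TV.l^[e] (TV.r h)

theorem symT_inj {a b : Γ'} {x y : T} : symT a x = symT b y ↔ a = b ∧ x = y := by
  cases a <;> cases b <;> simp [symT]

theorem symT_ne_eps (a : Γ') (x : T) : symT a x ≠ T.eps := by
  cases a <;> simp [symT]

theorem confT_inj {h h' : T} {f f' : K' → T} : confT h f = confT h' f' ↔ h = h' ∧ f = f' := by
  constructor
  · intro H
    simp only [confT, T.p.injEq] at H
    refine ⟨H.1, funext fun k => ?_⟩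
    cases k <;> simp [H]
  · rintro ⟨rfl, rfl⟩
    rfl

theorem confV_inj {h h' : TV} {f f' : K' → TV} :
    confV h f = confV h' f' ↔ h = h' ∧ f = f' := by
  constructor
  · intro H
    simp only [confV, TV.p.injEq] at H
    refine ⟨H.1, funext fun k => ?_⟩
    cases k <;> simp [H]
  · rintro ⟨rfl, rfl⟩
    rfl

theorem recV_inj {e e' : ℕ} {h h' : TV} (H : recV e h = recV e' h') : e = e' := by
  induction e generalizing e' with
  | zero => cases e' <;> simp_all [recV, Function.iterate_succ_apply']
  | succ e ih =>
    cases e' with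
    | zero => simp [recV, Function.iterate_succ_apply'] at H
    | succ e' =>
      simp only [recV, Function.iterate_succ_apply', TV.l.injEq] at H
      rw [ih H]

theorem substV_confV (σ : ℕ → TV) (h : TV) (f : K' → TV) :
    substV σ (confV h f) = confV (substV σ h) (fun k => substV σ (f k)) := rfl

theorem substV_recV (σ : ℕ → TV) (e : ℕ) (h : TV) :
    substV σ (recV e h) = recV e (substV σ h) := by
  induction e with
  | zero => rfl
  | succ e ih =>
    simp only [recV, Function.iterate_succ_apply'] at ih ⊢
    rw [substV, ih]

theorem substG_symV (σ : ℕ → T) (a : Γ') (x : TV) : substG σ (symV a x) = symT a (substG σ x) := by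
  cases a <;> rfl

theorem substG_wordV (σ : ℕ → T) (w : List Γ') (x : TV) :
    substG σ (wordV w x) = w.foldr symT (substG σ x) := by
  induction w with
  | nil => rfl
  | cons a w ih => exact (substG_symV σ a _).trans (congrArg (symT a) ih)

theorem substG_confV (σ : ℕ → T) (h : TV) (f : K' → TV) :
    substG σ (confV h f) = confT (substG σ h) (fun k => substG σ (f k)) := rfl

theorem substG_recV (σ : ℕ → T) (e : ℕ) (h : TV) :
    substG σ (recV e h) = recT e (substG σ h) := by
  induction e with
  | zero => rfl
  | succ e ih =>
    simp only [recV, recT, Function.iterate_succ_apply'] at ih ⊢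
    rw [substG, ih]

theorem occCount_wordV (v : ℕ) (w : List Γ') (x : TV) : occCount v (wordV w x) = occCount v x := by
  induction w with
  | nil => rfl
  | cons a w ih => cases a <;> simpa [wordV, symV, occCount] using ih

theorem occCount_recV (v e : ℕ) (x : TV) : occCount v (recV e x) = occCount v x := by
  induction e with
  | zero => rfl
  | succ e ih =>
    simp only [recV, Function.iterate_succ_apply'] at ih ⊢
    rw [occCount, ih]

/-- A machine with four stacks: in state `q` it reads the top of the stack `key q` (`none` if it
is empty), replaces it by a word and changes its state. State `1` is final. -/
structure StackMachine where
  /-- The number of states. -/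
  size : ℕ
  /-- The stack read in a state. -/
  key : ℕ → K'
  /-- The word written. -/
  word : ℕ → Option Γ' → List Γ'
  /-- The next state. -/
  next : ℕ → Option Γ' → ℕ
  next_lt : ∀ q o, next q o < size
  next_ne : ∀ q o, next q o ≠ 0
  one_lt_size : 1 < size

namespace StackMachine

variable (M : StackMachine)

/-- The step function. -/
def step (c : ℕ × (K' → List Γ')) : Option (ℕ × (K' → List Γ')) :=
  if c.1 = 1 then none else
    some (M.next c.1 (c.2 (M.key c.1)).head?,
      Function.update c.2 (M.key c.1)
        (M.word c.1 (c.2 (M.key c.1)).head? ++ (c.2 (M.key c.1)).tail))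

def symIndex : Option Γ' → ℕ
  | none => 0
  | some Γ'.consₗ => 1
  | some Γ'.cons => 2
  | some Γ'.bit0 => 3
  | some Γ'.bit1 => 4

def stackIndex : K' → ℕ
  | K'.main => 1
  | K'.rev => 2
  | K'.aux => 3
  | K'.stack => 4

def index (x : ℕ × Option Γ') : ℕ := 5 * x.1 + symIndex x.2

theorem index_injective : Function.Injective index := by
  rintro ⟨q, o⟩ ⟨q', o'⟩ h
  rcases o with _ | _ | _ | _ | _ <;> rcases o' with _ | _ | _ | _ | _ <;>
    simp only [index, symIndex, Prod.mk.injEq] at h ⊢ <;> simp <;> omega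

/-- The variable for the part of stack `k` left untouched by the rule with index `e`. -/
def stackVar (e : ℕ) (k : K') : TV := TV.var (5 * e + stackIndex k)

/-- The part of the stack below the symbol read. -/
def below (e : ℕ) (k : K') : Option Γ' → TV
  | none => TV.eps
  | some _ => stackVar e k

/-- The stack terms of a rule that has the word `w` on top of the stack read. -/
def stacksV (x : ℕ × Option Γ') (w : List Γ') : K' → TV :=
  Function.update (stackVar (index x)) (M.key x.1)
    (wordV w (below (index x) (M.key x.1) x.2))

/-- The rule for a state and a symbol read. -/
def rule (x : ℕ × Option Γ') : Rule :=
  (x.1, confV (TV.var (5 * index x)) (M.stacksV x x.2.toList),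
    confV (recV (index x) (TV.var (5 * index x))) (M.stacksV x (M.word x.1 x.2)),
    M.next x.1 x.2)

/-- The pattern-matching automaton of a stack machine. -/
def toPMA : PMA :=
  ⟨Finset.range M.size, 0, 1, (((Finset.range M.size).erase 1) ×ˢ Finset.univ).image M.rule⟩

theorem occCount_stacksV_eq (x : ℕ × Option Γ') (w w' : List Γ') (v : ℕ) (k : K') :
    occCount v (M.stacksV x w k) = occCount v (M.stacksV x w' k) := by
  rcases eq_or_ne k (M.key x.1) with rfl | hk
  · simp [stacksV, occCount_wordV]
  · simp [stacksV, hk]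

theorem occCount_rule (x : ℕ × Option Γ') (v : ℕ) :
    occCount v (ruleRhs (M.rule x)) = occCount v (ruleLhs (M.rule x)) := by
  simp only [rule, ruleRhs, ruleLhs, confV, occCount, occCount_recV,
    M.occCount_stacksV_eq x (M.word x.1 x.2) x.2.toList]

theorem occCount_stacksV (x : ℕ × Option Γ') (w : List Γ') (v : ℕ) (k : K') :
    occCount v (M.stacksV x w k) = 0 ∨
      occCount v (M.stacksV x w k) = 1 ∧ 5 * index x + stackIndex k = v := by
  rcases eq_or_ne k (M.key x.1) with rfl | hk
  · rcases x with ⟨q, _ | a⟩ <;> simp [stacksV, occCount_wordV, below, stackVar, occCount, em']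
  · simp [stacksV, hk, stackVar, occCount, em']

theorem occCount_ruleLhs_le (x : ℕ × Option Γ') (v : ℕ) :
    occCount v (ruleLhs (M.rule x)) ≤ if v / 5 = index x then 1 else 0 := by
  have h := M.occCount_stacksV x x.2.toList v
  have h1 := h K'.main
  have h2 := h K'.rev
  have h3 := h K'.aux
  have h4 := h K'.stack
  simp only [rule, ruleLhs, confV, occCount, stackIndex] at h1 h2 h3 h4 ⊢
  split_ifs <;> omega

theorem div_eq_index_of_mem_ruleVars {x : ℕ × Option Γ'} {v : ℕ} (h : v ∈ ruleVars (M.rule x)) :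
    v / 5 = index x := by
  have := M.occCount_ruleLhs_le x v
  simp only [ruleVars, Finset.mem_union, mem_varsOf_iff, occCount_rule, or_self] at h
  by_contra hne
  rw [if_neg hne] at this
  omega

theorem wellFormed_toPMA : M.toPMA.WellFormed := by
  have := M.one_lt_size
  refine ⟨by simp [toPMA]; omega, by simpa [toPMA] using this, by simp [toPMA], ?_, ?_⟩
  · simp only [toPMA, Finset.forall_mem_image]
    rintro ⟨q, o⟩ hx
    simp only [Finset.mem_product, Finset.mem_erase, Finset.mem_range, Finset.mem_univ,
      and_true] at hx
    refine ⟨by simpa [ruleSrc, rule] using hx.2, by simpa [ruleTgt, rule] using M.next_lt q o,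
      fun v hv => ?_, M.next_ne q o, hx.1⟩
    rw [mem_varsOf_iff] at hv ⊢
    rwa [← occCount_rule]
  · simp only [toPMA, Finset.forall_mem_image]
    intro x _ y _ hne
    rw [Finset.disjoint_left]
    intro v hv hv'
    have := (M.div_eq_index_of_mem_ruleVars hv).symm.trans (M.div_eq_index_of_mem_ruleVars hv')
    exact hne (congrArg _ (index_injective this))

theorem biorthogonal_toPMA : M.toPMA.Biorthogonal := by
  rw [PMA.Biorthogonal, orthogonal_op_iff, PMA.Orthogonal]
  simp only [toPMA, Finset.forall_mem_image, occCount_rule]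
  have hlin : ∀ (x : ℕ × Option Γ') (v : ℕ), occCount v (ruleLhs (M.rule x)) ≤ 1 := fun x v =>
    (M.occCount_ruleLhs_le x v).trans (by split_ifs <;> omega)
  refine ⟨⟨?_, fun x _ => hlin x⟩, ?_, fun x _ => hlin x⟩
  · rintro ⟨q, o⟩ _ ⟨q', o'⟩ _ hne he ⟨σ, hσ⟩
    obtain rfl : q = q' := he
    simp only [rule, ruleLhs, substV_confV, confV_inj] at hσ
    have := congrFun hσ.2 (M.key q)
    simp only [stacksV, Function.update_self] at this
    refine hne ?_
    rcases o with _ | _ | _ | _ | _ <;> rcases o' with _ | _ | _ | _ | _ <;>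
      simp [wordV, symV, substV, below] at this <;> rfl
  · rintro x _ y _ hne _ ⟨σ, hσ⟩
    simp only [rule, ruleRhs, substV_confV, confV_inj, substV_recV] at hσ
    exact hne (congrArg _ (index_injective (recV_inj hσ.1)))

/-- The configuration of the automaton for a configuration of the machine and a history. -/
def cfg (c : ℕ × (K' → List Γ')) (h : T) : ℕ × T := (c.1, confT h fun k => wordT (c.2 k))

variable {M}

theorem exists_step_of_mem_step {c c' : ℕ × (K' → List Γ')} (hc : c.1 < M.size)
    (hs : c' ∈ M.step c) (h : T) : ∃ h', M.toPMA.Step (cfg c h) (cfg c' h') := by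
  obtain ⟨q, S⟩ := c
  rw [step] at hs
  split at hs
  · simp at hs
  next hq =>
  obtain rfl := Option.some.inj hs
  let x : ℕ × Option Γ' := (q, (S (M.key q)).head?)
  let g : K' → T := fun k => wordT (Function.update S (M.key q) (S (M.key q)).tail k)
  let σ : ℕ → T := fun v => match v - 5 * index x with
    | 0 => h
    | 1 => g K'.main
    | 2 => g K'.rev
    | 3 => g K'.aux
    | _ => g K'.stack
  have h0 : σ (5 * index x) = h := by simp [σ]
  have hσ : ∀ k, substG σ (stackVar (index x) k) = g k := by
    intro k
    cases k <;> simp [σ, stackVar, substG, stackIndex]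
  have hb : substG σ (below (index x) (M.key q) x.2) = wordT (S (M.key q)).tail := by
    cases hS : S (M.key q) with
    | nil => simp [x, hS, below, substG, wordT]
    | cons a w =>
      have hx : x.2 = some a := by simp [x, hS]
      rw [hx, below, hσ]
      simp [g, hS]
  have hst : ∀ w : List Γ', (fun k => substG σ (M.stacksV x w k)) =
      fun k => wordT (Function.update S (M.key q) (w ++ (S (M.key q)).tail) k) := by
    intro w
    funext k
    rcases eq_or_ne k (M.key q) with rfl | hk
    · simp only [stacksV, x, Function.update_self]
      rw [substG_wordV, hb, wordT, wordT, List.foldr_append]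
    · simp [stacksV, x, hk]
      rw [hσ]
      simp [g, hk]
  refine ⟨recT (index x) h, M.rule x, ?_, rfl, rfl, σ, ?_, ?_⟩
  · refine Finset.mem_coe.2 (Finset.mem_image_of_mem _ ?_)
    simpa [x] using ⟨hq, hc⟩
  · simp only [rule, ruleLhs, substG_confV, hst, substG, h0, cfg, confT_inj, true_and]
    have : x.2.toList ++ (S (M.key q)).tail = S (M.key q) := by
      cases hS : S (M.key q) <;> simp [x, hS]
    rw [this, Function.update_eq_self]
  · simp only [rule, ruleRhs, substG_confV, hst, substG, h0, cfg, substG_recV, confT_inj, true_and]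
    rfl

theorem exists_mem_step_of_step {c : ℕ × (K' → List Γ')} {h : T} {d : ℕ × T}
    (hs : M.toPMA.Step (cfg c h) d) : ∃ c' ∈ M.step c, ∃ h', d = cfg c' h' := by
  obtain ⟨q, S⟩ := c
  obtain ⟨q', u⟩ := d
  obtain ⟨ρ, hρ, h1, h2, σ, h3, h4⟩ := hs
  obtain ⟨⟨q, o⟩, hx, rfl⟩ := Finset.mem_image.1 (Finset.mem_coe.1 hρ)
  obtain rfl : q = _ := h1
  simp only [Finset.mem_product, Finset.mem_erase, Finset.mem_range, Finset.mem_univ,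
      and_true] at hx
  simp only [rule, ruleTgt, ruleLhs, ruleRhs, cfg, substG_confV, confT_inj] at h2 h3 h4
  obtain ⟨-, h3⟩ := h3
  have hk := congrFun h3 (M.key q)
  simp only [stacksV, Function.update_self, substG_wordV] at hk
  have hkey : o = (S (M.key q)).head? ∧
      substG σ (below (index (q, o)) (M.key q) o) = wordT (S (M.key q)).tail := by
    cases hS : S (M.key q) with
    | nil =>
      cases o with
      | none => simp [below, substG, wordT]
      | some a => exact absurd (by simpa [hS, wordT] using hk) (symT_ne_eps _ _)
    | cons b w =>
      cases o with
      | none => exact absurd (by simpa [hS, wordT, below, substG] using hk.symm) (symT_ne_eps _ _)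
      | some a =>
        have : a = b ∧ _ := symT_inj.1 (by simpa [hS, wordT] using hk)
        exact ⟨by simp [this.1], this.2⟩
  obtain ⟨ho, hb⟩ := hkey
  refine ⟨_, by rw [step, if_neg hx.1]; rfl,
    recT (index (q, o)) (substG σ (TV.var (5 * index (q, o)))), ?_⟩
  subst h2 h4
  simp only [cfg, Prod.mk.injEq, ← ho, substG_recV, confT_inj, true_and]
  funext k
  rcases eq_or_ne k (M.key q) with rfl | hk
  · simp only [stacksV, Function.update_self]
    rw [substG_wordV, hb, wordT, wordT, List.foldr_append]
  · have := congrFun h3 k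
    simp only [stacksV, Function.update_of_ne hk] at this ⊢
    exact this

theorem exists_rel_toPMA_iff {S : K' → List Γ'} :
    (∃ t', M.toPMA.Rel (confT T.eps fun k => wordT (S k)) t') ↔
      (StateTransition.eval M.step (0, S)).Dom := by
  have hnone : ∀ c, M.step c = none ↔ c.1 = 1 := by
    intro c
    rw [step]
    split_ifs with h <;> simp [h]
  constructor
  · rintro ⟨t', ht⟩
    have key : ∀ d, Relation.ReflTransGen M.toPMA.Step (cfg (0, S) T.eps) d →
        ∃ c h, d = cfg c h ∧ StateTransition.Reaches M.step (0, S) c := by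
      intro d hd
      induction hd with
      | refl => exact ⟨_, _, rfl, .refl⟩
      | tail _ hs ih =>
        obtain ⟨c, h, rfl, hr⟩ := ih
        obtain ⟨c', hc', h', rfl⟩ := exists_mem_step_of_step hs
        exact ⟨c', h', rfl, hr.tail hc'⟩
    obtain ⟨c, h, hd, hr⟩ := key _ ht
    refine Part.dom_iff_mem.2 ⟨c, StateTransition.mem_eval.2 ⟨hr, (hnone c).2 ?_⟩⟩
    exact (congrArg Prod.fst hd).symm
  · intro hd
    obtain ⟨c, hc⟩ := Part.dom_iff_mem.1 hd
    obtain ⟨hr, hn⟩ := StateTransition.mem_eval.1 hc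
    have key : ∀ c, StateTransition.Reaches M.step (0, S) c → c.1 < M.size ∧
        ∃ h, Relation.ReflTransGen M.toPMA.Step (cfg (0, S) T.eps) (cfg c h) := by
      intro c hc
      induction hc with
      | refl => exact ⟨(by have := M.one_lt_size; omega : 0 < M.size), _, .refl⟩
      | tail _ hs ih =>
        obtain ⟨hlt, h, hr⟩ := ih
        obtain ⟨h', hs'⟩ := exists_step_of_mem_step hlt hs h
        refine ⟨?_, h', hr.tail hs'⟩
        rw [step] at hs
        split at hs
        · simp at hs
        · obtain rfl := Option.some.inj hs
          exact M.next_lt _ _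
    obtain ⟨-, h, hr⟩ := key c hr
    have he : cfg c h = (1, (cfg c h).2) := by rw [← (hnone c).1 hn]; rfl
    rw [he] at hr
    exact ⟨_, hr⟩

end StackMachine

end StackMachine

section StackMachineOfTM2

open Turing Turing.PartrecToTM2 StateTransition

/-- A statement together with the content of the local store. -/
abbrev Node := TM2.Stmt (fun _ : K' => Γ') Λ' (Option Γ') × Option Γ'

/-- The stack that the first instruction of a statement acts on. -/
def Node.key : Node → K'
  | (.push k _ _, _) => k
  | (.peek k _ _, _) => k
  | (.pop k _ _, _) => k
  | _ => K'.main

/-- The word that the first instruction of a statement writes in place of the top `o` of its stack,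
and the node that follows (`none` if the statement halts). -/
def Node.act : Node → Option Γ' → List Γ' × Option Node
  | (.push _ f q, s), o => (f s :: o.toList, some (q, s))
  | (.peek _ f q, s), o => (o.toList, some (q, f s o))
  | (.pop _ f q, s), o => ([], some (q, f s o))
  | (.load a q, s), o => (o.toList, some (q, a s))
  | (.branch f q₁ q₂, s), o => (o.toList, some (cond (f s) q₁ q₂, s))
  | (.goto l, s), o => (o.toList, some (tr (l s), s))
  | (.halt, _), o => (o.toList, none)

/-- The number of a node in a list, as a state; `none` is the final state. -/
noncomputable def nodeIndex (L : List Node) : Option Node → ℕ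
  | none => 1
  | some n => haveI := Classical.decEq Node; L.idxOf n + 2

/-- The stack machine that starts with the node `n` and whose nodes are listed in `L`. -/
noncomputable def nodeMachine (L : List Node) (n : Node) : StackMachine where
  size := L.length + 3
  key q := if q = 0 then K'.main else (L.getD (q - 2) n).key
  word q o := if q = 0 then o.toList else ((L.getD (q - 2) n).act o).1
  next q o := nodeIndex L (if q = 0 then some n else ((L.getD (q - 2) n).act o).2)
  next_lt q o := by
    generalize (if q = 0 then some n else ((L.getD (q - 2) n).act o).2) = x
    cases x with
    | none => simp [nodeIndex]
    | some x =>
      let _ := Classical.decEq Node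
      have : L.idxOf x ≤ L.length := List.idxOf_le_length
      simp only [nodeIndex]
      exact Nat.lt_succ_of_le (Nat.add_le_add_right this 2)
  next_ne q o := by
    generalize (if q = 0 then some n else ((L.getD (q - 2) n).act o).2) = x
    cases x <;> simp [nodeIndex]
  one_lt_size := by omega

theorem head?_toList_append_tail {α : Type*} (w : List α) : w.head?.toList ++ w.tail = w := by
  cases w <;> rfl

theorem step_nodeMachine_zero (L : List Node) (n : Node) (S : K' → List Γ') :
    (nodeMachine L n).step (0, S) = some (nodeIndex L (some n), S) := by
  simp [StackMachine.step, nodeMachine, head?_toList_append_tail]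

theorem step_nodeMachine {L : List Node} {n n' : Node} (h : n' ∈ L) (S : K' → List Γ') :
    (nodeMachine L n).step (nodeIndex L (some n'), S) =
      some (nodeIndex L (n'.act (S n'.key).head?).2,
        Function.update S n'.key ((n'.act (S n'.key).head?).1 ++ (S n'.key).tail)) := by
  let _ := Classical.decEq Node
  have h1 : nodeIndex L (some n') = L.idxOf n' + 2 := rfl
  have h2 : L.getD (L.idxOf n') n = n' := by
    rw [List.getD_eq_getElem _ _ (List.idxOf_lt_length_iff.2 h), List.getElem_idxOf]
  rw [StackMachine.step, if_neg (by simp [h1])]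
  simp only [nodeMachine, h1, Nat.add_eq_zero_iff, OfNat.ofNat_ne_zero, and_false, if_false,
    Nat.add_sub_cancel, h2]

/-- The correspondence between configurations of the TM2 machine and of the stack machine. -/
def NodeRel (L : List Node) (c : TM2.Cfg (fun _ : K' => Γ') Λ' (Option Γ'))
    (d : ℕ × (K' → List Γ')) : Prop :=
  d = (nodeIndex L (c.l.map fun l => (tr l, c.var)), c.stk) ∧ ∀ l ∈ c.l, (tr l, c.var) ∈ L

theorem exists_nodeRel_stepAux {L : List Node} (n : Node)
    (hL : ∀ m ∈ L, ∀ o, ∀ m' ∈ (m.act o).2, m' ∈ L)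
    (q : TM2.Stmt (fun _ : K' => Γ') Λ' (Option Γ')) (s : Option Γ') (S : K' → List Γ')
    (h : (q, s) ∈ L) :
    ∃ d, NodeRel L (TM2.stepAux q s S) d ∧
      Reaches₁ (nodeMachine L n).step (nodeIndex L (some (q, s)), S) d := by
  have hs := step_nodeMachine (n := n) h S
  have hm := hL _ h
  induction q generalizing s S with
  | push k f q ih =>
    have h' := hm none _ rfl
    obtain ⟨d, hd, hr⟩ := ih s (Function.update S k (f s :: S k)) h' (step_nodeMachine h' _) (hL _ h')
    refine ⟨d, hd, .head ?_ hr⟩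
    rw [hs]
    simp [Node.key, Node.act, head?_toList_append_tail]
  | peek k f q ih =>
    have h' := hm (S k).head? _ rfl
    obtain ⟨d, hd, hr⟩ := ih _ S h' (step_nodeMachine h' _) (hL _ h')
    refine ⟨d, hd, .head ?_ hr⟩
    rw [hs]
    simp [Node.key, Node.act, head?_toList_append_tail]
  | pop k f q ih =>
    have h' := hm (S k).head? _ rfl
    obtain ⟨d, hd, hr⟩ :=
      ih _ (Function.update S k (S k).tail) h' (step_nodeMachine h' _) (hL _ h')
    refine ⟨d, hd, .head ?_ hr⟩
    rw [hs]
    simp [Node.key, Node.act]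
  | load a q ih =>
    have h' := hm none _ rfl
    obtain ⟨d, hd, hr⟩ := ih _ S h' (step_nodeMachine h' _) (hL _ h')
    refine ⟨d, hd, .head ?_ hr⟩
    rw [hs]
    simp [Node.key, Node.act, head?_toList_append_tail]
  | branch f q₁ q₂ ih₁ ih₂ =>
    have h' := hm none _ rfl
    cases hf : f s with
    | true =>
      rw [hf] at h'
      obtain ⟨d, hd, hr⟩ := ih₁ _ S h' (step_nodeMachine h' _) (hL _ h')
      refine ⟨d, by simpa [hf] using hd, .head ?_ hr⟩
      rw [hs]
      simp [Node.key, Node.act, head?_toList_append_tail, hf]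
    | false =>
      rw [hf] at h'
      obtain ⟨d, hd, hr⟩ := ih₂ _ S h' (step_nodeMachine h' _) (hL _ h')
      refine ⟨d, by simpa [hf] using hd, .head ?_ hr⟩
      rw [hs]
      simp [Node.key, Node.act, head?_toList_append_tail, hf]
  | goto l =>
    have h' := hm none _ rfl
    refine ⟨_, ⟨rfl, fun l' hl' => ?_⟩, .single ?_⟩
    · obtain rfl : l s = l' := Option.some.inj hl'
      exact h'
    · rw [hs]
      simp [Node.key, Node.act, head?_toList_append_tail]
  | halt =>
    refine ⟨_, ⟨rfl, fun l' hl' => by simp at hl'⟩, .single ?_⟩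
    rw [hs]
    simp [Node.key, Node.act, head?_toList_append_tail]

theorem respects_nodeMachine {L : List Node} (n : Node)
    (hL : ∀ m ∈ L, ∀ o, ∀ m' ∈ (m.act o).2, m' ∈ L) :
    Respects (TM2.step tr) (nodeMachine L n).step (NodeRel L) := by
  rintro ⟨_ | l, v, S⟩ _ ⟨rfl, h⟩
  · exact if_pos rfl
  · exact exists_nodeRel_stepAux n hL _ _ _ (h l rfl)

theorem act_mem_of_supports {Λs : Finset Λ'}
    (hΛ : ∀ l ∈ Λs, TM2.SupportsStmt Λs (tr l)) {m m' : Node} {o : Option Γ'}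
    (h : ∃ l ∈ Λs, m.1 ∈ TM2.stmts₁ (tr l)) (hm : m' ∈ (m.act o).2) :
    ∃ l ∈ Λs, m'.1 ∈ TM2.stmts₁ (tr l) := by
  obtain ⟨l, hl, hs⟩ := h
  have ht := TM2.stmts₁_trans hs
  have hsup := TM2.stmts₁_supportsStmt_mono hs (hΛ l hl)
  obtain ⟨q, s⟩ := m
  cases q with
  | goto f =>
    obtain rfl := Option.some.inj hm
    exact ⟨f s, hsup s, TM2.stmts₁_self⟩
  | halt => simp [Node.act] at hm
  | branch f q₁ q₂ =>
    obtain rfl := Option.some.inj hm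
    refine ⟨l, hl, ht ?_⟩
    cases f s <;> simp [TM2.stmts₁, TM2.stmts₁_self]
  | _ =>
    obtain rfl := Option.some.inj hm
    exact ⟨l, hl, ht (by simp [TM2.stmts₁, TM2.stmts₁_self])⟩

theorem exists_stackMachine (c : ToPartrec.Code) :
    ∃ M : StackMachine, ∀ v : List ℕ,
      (eval M.step (0, K'.elim (trList v) [] [] [])).Dom ↔ (c.eval v).Dom := by
  classical
  have hsup := tr_supports c Cont'.halt
  let F : Finset Node :=
    ((codeSupp c Cont'.halt).biUnion fun l => TM2.stmts₁ (tr l)) ×ˢ Finset.univ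
  have hF : ∀ m : Node, m ∈ F.toList ↔ ∃ l ∈ codeSupp c Cont'.halt, m.1 ∈ TM2.stmts₁ (tr l) := by
    intro m
    simp [F]
  have hL : ∀ m ∈ F.toList, ∀ o, ∀ m' ∈ (m.act o).2, m' ∈ F.toList := by
    intro m hm o m' hm'
    rw [hF] at hm ⊢
    exact act_mem_of_supports hsup.2 hm hm'
  let n : Node := (tr (trNormal c Cont'.halt), none)
  refine ⟨nodeMachine F.toList n, fun v => ?_⟩
  have hr : NodeRel F.toList (init c v)
      (nodeIndex F.toList (some n), K'.elim (trList v) [] [] []) := by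
    refine ⟨rfl, fun l hl => ?_⟩
    obtain rfl : trNormal c Cont'.halt = l := Option.some.inj hl
    exact (hF _).2 ⟨_, hsup.1, TM2.stmts₁_self⟩
  rw [reaches_eval (.single (step_nodeMachine_zero F.toList n _)),
    tr_eval_dom (respects_nodeMachine n hL) hr, PartrecToTM2.tr_eval]
  rfl

end StackMachineOfTM2

theorem encPMA_injective : Function.Injective encPMA := by
  intro A B h
  have hQ : A.Q = B.Q := by
    ext q
    rw [← mem_stateCodes_encPMA, h, mem_stateCodes_encPMA]
  have hi : A.qi = B.qi := by rw [← initCode_encPMA, h, initCode_encPMA]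
  have hf : A.qf = B.qf := by rw [← finalCode_encPMA, h, finalCode_encPMA]
  have hR : A.R = B.R := by
    ext ρ
    rw [← encRule_mem_ruleCodes, h, encRule_mem_ruleCodes]
  cases A
  cases B
  simp_all

theorem pair_mem_Hset_iff {A : PMA} (hw : A.WellFormed) (hb : A.Biorthogonal) {t : T} :
    Nat.pair (encPMA A) (encT t) ∈ Hset ↔ ∃ t', A.Rel t t' := by
  constructor
  · rintro ⟨B, u, -, -, h, ht⟩
    obtain ⟨h1, h2⟩ := Nat.pair_eq_pair.1 h
    rwa [encPMA_injective h1, encT_injective h2]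
  · exact fun h => ⟨A, t, hw, hb, rfl, h⟩

section Reduction

open Turing Turing.PartrecToTM2 StateTransition

theorem trNat_bit0 {n : ℕ} (h : n ≠ 0) : trNat (2 * n) = Γ'.bit0 :: trNat n := by
  have e : ((2 * n : ℕ) : Num) = (n : Num).bit0 := by
    rw [← Num.ofNat'_eq, ← Num.ofNat'_eq, ← Nat.bit_false_apply, Num.ofNat'_bit]
    rfl
  rw [trNat, e, trNat]
  cases hn : (n : Num) with
  | zero => exact absurd (by simpa using congrArg (fun x : Num => (x : ℕ)) hn) h
  | pos p => rfl

theorem trNat_bit1 (n : ℕ) : trNat (2 * n + 1) = Γ'.bit1 :: trNat n := by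
  have e : ((2 * n + 1 : ℕ) : Num) = (n : Num).bit1 := by
    rw [← Num.ofNat'_eq, ← Num.ofNat'_eq, ← Nat.bit_true_apply, Num.ofNat'_bit]
    rfl
  rw [trNat, e, trNat]
  cases (n : Num) <;> rfl

/-- The code of the term for the stack holding the input `n`. -/
def inputCode (n : ℕ) : ℕ := encT (wordT (trList [n]))

theorem inputCode_zero : inputCode 0 = 9 := by
  simp [inputCode, trList, wordT, symT, encT]

theorem inputCode_of_ne_zero {n : ℕ} (h : n ≠ 0) :
    inputCode n = 16 * inputCode (n / 2) + 6 + 4 * (n % 2) := by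
  rcases Nat.even_or_odd' n with ⟨k, rfl | rfl⟩
  · have hk : k ≠ 0 := by omega
    have h1 : 2 * k / 2 = k := by omega
    have h2 : 2 * k % 2 = 0 := by omega
    rw [h1, h2]
    simp only [inputCode, trList, trNat_bit0 hk, List.cons_append, wordT, List.foldr_cons, symT,
      encT]
    ring
  · have h1 : (2 * k + 1) / 2 = k := by omega
    have h2 : (2 * k + 1) % 2 = 1 := by omega
    rw [h1, h2]
    simp only [inputCode, trList, trNat_bit1, List.cons_append, wordT, List.foldr_cons, symT,
      encT]
    ring

theorem primrec_inputCode : Primrec inputCode := by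
  have hg : Primrec₂ fun (_ : Unit) (L : List ℕ) => if L.length = 0 then some 9 else
      L[L.length / 2]?.map fun x => 16 * x + 6 + 4 * (L.length % 2) := by
    have hl : Primrec fun x : Unit × List ℕ => x.2.length :=
      Primrec.list_length.comp Primrec.snd
    refine Primrec.ite (Primrec.eq.comp hl (Primrec.const 0)) (Primrec.const _)
      (Primrec.option_map ?_ ?_)
    · exact Primrec.list_getElem?.comp Primrec.snd (Primrec.nat_div.comp hl (Primrec.const 2))
    · exact Primrec.nat_add.comp
        (Primrec.nat_add.comp (Primrec.nat_mul.comp (Primrec.const 16) Primrec.snd)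
          (Primrec.const 6))
        (Primrec.nat_mul.comp (Primrec.const 4)
          (Primrec.nat_mod.comp (hl.comp Primrec.fst) (Primrec.const 2)))
  refine (Primrec.nat_strong_rec (fun (_ : Unit) n => inputCode n) hg fun _ n => ?_).comp
    (Primrec.const ()) Primrec.id
  rcases eq_or_ne n 0 with rfl | hn
  · simp [inputCode_zero]
  · have : n / 2 < n := by omega
    simp [hn, this, inputCode_of_ne_zero hn]

theorem primrec_encT_confT : Primrec fun n : ℕ =>
    encT (confT T.eps fun k => wordT (K'.elim (trList [n]) [] [] [] k)) := by
  have hp : ∀ {f g : ℕ → ℕ}, Primrec f → Primrec g →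
      Primrec fun n => 4 * Nat.pair (f n) (g n) + 3 := fun hf hg =>
    Primrec.nat_add.comp
      (Primrec.nat_mul.comp (Primrec.const 4) (Primrec₂.natPair.comp hf hg)) (Primrec.const 3)
  exact hp (Primrec.const (encT T.eps)) (hp (hp primrec_inputCode (Primrec.const (encT T.eps)))
    (hp (Primrec.const (encT T.eps)) (Primrec.const (encT T.eps))))

theorem exists_computable_mem_Hset_iff {g : ℕ →. ℕ} (hg : Nat.Partrec g) :
    ∃ h : ℕ → ℕ, Computable h ∧ ∀ n, (g n).Dom ↔ h n ∈ Hset := by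
  obtain ⟨c, hc⟩ := ToPartrec.Code.exists_code
    (Nat.Partrec'.part_iff₁.2 (Partrec.nat_iff.2 hg))
  obtain ⟨M, hM⟩ := exists_stackMachine c
  refine ⟨fun n => Nat.pair (encPMA M.toPMA)
    (encT (confT T.eps fun k => wordT (K'.elim (trList [n]) [] [] [] k))),
    (Primrec₂.natPair.comp (Primrec.const _) primrec_encT_confT).to_comp, fun n => ?_⟩
  rw [pair_mem_Hset_iff M.wellFormed_toPMA M.biorthogonal_toPMA,
    StackMachine.exists_rel_toPMA_iff, hM, show [n] = (n ::ᵥ .nil : List.Vector ℕ 1).1 from rfl, hc]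
  rfl

theorem not_exists_computable_decide_Hset :
    ¬ ∃ d : ℕ → Bool, Computable d ∧ ∀ n, d n = true ↔ n ∈ Hset := by
  rintro ⟨d, hd, hdH⟩
  have hp : Nat.Partrec fun n => Nat.Partrec.Code.eval (Denumerable.ofNat _ n) 0 :=
    Partrec.nat_iff.1 (Nat.Partrec.Code.eval_part.comp (Computable.ofNat _) (Computable.const 0))
  obtain ⟨h, hh, hH⟩ := exists_computable_mem_Hset_iff hp
  refine ComputablePred.halting_problem 0 (ComputablePred.computable_iff.2
    ⟨fun c => d (h (Encodable.encode c)), hd.comp (hh.comp Computable.encode), ?_⟩)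
  funext c
  rw [eq_iff_iff, hdH, ← hH, Denumerable.ofNat_encode]

end Reduction

/-- Termination in biorthogonal pattern-matching automata is `Σ⁰₁`-complete:
`H` is recursively enumerable; every recursively enumerable set of naturals many-one
reduces to `H` via a total computable function; and in particular `H` is undecidable. -/
theorem halting_sigma01_complete :
    (∃ f : ℕ →. ℕ, Nat.Partrec f ∧ ∀ n, n ∈ Hset ↔ (f n).Dom) ∧
    (∀ W : Set ℕ,
      (∃ g : ℕ →. ℕ, Nat.Partrec g ∧ ∀ n, n ∈ W ↔ (g n).Dom) →
      ∃ h : ℕ → ℕ, Computable h ∧ ∀ n, n ∈ W ↔ h n ∈ Hset) ∧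
    ¬ ∃ d : ℕ → Bool, Computable d ∧ ∀ n, d n = true ↔ n ∈ Hset := by
  refine ⟨exists_partrec_dom_iff_mem_Hset, ?_, not_exists_computable_decide_Hset⟩
  rintro W ⟨g, hg, hW⟩
  obtain ⟨h, hh, hH⟩ := exists_computable_mem_Hset_iff hg
  exact ⟨h, hh, fun n => (hW n).trans (hH n)⟩
end
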